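/- For Q of finite (Dynkin) type, there is a bijection between torsion classes in rep Q and cox(Q)-sortable elements of W, given by T ↦ w_T where w_T is the unique element whose inversion set I(w_T) equals Ind(T), the set of positive roots that are dimension vectors of indecomposable objects of T. -/

import Mathlib

open CategoryTheory CategoryTheory.Limits ZeroObject

attribute [local instance] CategoryTheory.Abelian.hasFiniteBiproducts

noncomputable section

namespace NCPaper

/-- A finite quiver without oriented cycles. -/
structure FinQuiver : Type 1 where
  V : Type
  [quiver : Quiver.{0} V]
  [fintypeV : Fintype V]
  [fintypeArr : ∀ a b : V, Fintype (a ⟶ b)]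
  acyclic : ∀ (v : V) (p : Quiver.Path v v), p = Quiver.Path.nil

attribute [instance] FinQuiver.quiver FinQuiver.fintypeV FinQuiver.fintypeArr

variable (k : Type) [Field k] (Q : FinQuiver)

/-- The ambient abelian category of all `k`-linear representations of `Q`;
finite-dimensional representations are singled out by the predicate `FinDim`. -/
abbrev RepC : Type 1 := Paths Q.V ⥤ ModuleCat.{0} k

variable {k Q}

/-- `M` is a finite-dimensional representation, i.e. an object of `rep Q`. -/
def FinDim (M : RepC k Q) : Prop :=
  ∀ v : Q.V, FiniteDimensional k (M.obj ((Paths.of Q.V).obj v))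

section Cat

variable {C : Type*} [Category C] [Abelian C]

/-- `X` is a direct summand of `A`. -/
def IsSummand (X A : C) : Prop := ∃ (i : X ⟶ A) (r : A ⟶ X), i ≫ r = 𝟙 X

/-- The additive closure of a set of objects: direct summands of finite direct sums. -/
def addSet (S : Set C) : Set C :=
  { X | ∃ (n : ℕ) (f : Fin n → C), (∀ i, f i ∈ S) ∧ IsSummand X (⨁ f) }

/-- `Gen S`: all quotients of objects of the additive closure of `S`. -/
def gen (S : Set C) : Set C := { X | ∃ A ∈ addSet S, ∃ p : A ⟶ X, Epi p }

/-- All morphisms from `A` to `B` vanish. -/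
def HomZero (A B : C) : Prop := ∀ f : A ⟶ B, f = 0

/-- `Ext¹(A, B) = 0`, expressed by the splitting of all short exact sequences
`0 ⟶ B ⟶ E ⟶ A ⟶ 0`. -/
def Ext1Zero (A B : C) : Prop :=
  ∀ (E : C) (i : B ⟶ E) (p : E ⟶ A) (w : i ≫ p = 0),
    (ShortComplex.mk i p w).ShortExact → ∃ r : E ⟶ B, i ≫ r = 𝟙 B

/-- An indecomposable object. -/
def Indec (X : C) : Prop :=
  ¬ IsZero X ∧ ∀ (A B : C), (X ≅ A ⊞ B) → IsZero A ∨ IsZero B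

/-- A torsion class: a full subcategory (identified with its set of objects) closed under
direct sums, direct summands, quotients and extensions. -/
structure IsTorsionClass (T : Set C) : Prop where
  zero_mem : (0 : C) ∈ T
  sum_mem : ∀ X ∈ T, ∀ Y ∈ T, (X ⊞ Y : C) ∈ T
  summand_mem : ∀ X ∈ T, ∀ Y : C, IsSummand Y X → Y ∈ T
  quot_mem : ∀ X ∈ T, ∀ (Y : C) (p : X ⟶ Y), Epi p → Y ∈ T
  ext_mem : ∀ S : ShortComplex C, S.ShortExact → S.X₁ ∈ T → S.X₃ ∈ T → S.X₂ ∈ T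

/-- A wide subcategory: a full subcategory (closed under direct sums and summands)
which is exact abelian (closed under kernels and cokernels) and closed under extensions. -/
structure IsWide (A : Set C) : Prop where
  zero_mem : (0 : C) ∈ A
  sum_mem : ∀ X ∈ A, ∀ Y ∈ A, (X ⊞ Y : C) ∈ A
  summand_mem : ∀ X ∈ A, ∀ Y : C, IsSummand Y X → Y ∈ A
  ker_mem : ∀ X ∈ A, ∀ Y ∈ A, ∀ f : X ⟶ Y, (kernel f : C) ∈ A
  coker_mem : ∀ X ∈ A, ∀ Y ∈ A, ∀ f : X ⟶ Y, (cokernel f : C) ∈ A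
  ext_mem : ∀ S : ShortComplex C, S.ShortExact → S.X₁ ∈ A → S.X₃ ∈ A → S.X₂ ∈ A

/-- `P` is split projective in the subcategory `T`: every epimorphism onto `P`
from an object of `T` splits. -/
def SplitProjIn (T : Set C) (P : C) : Prop :=
  P ∈ T ∧ ∀ X ∈ T, ∀ p : X ⟶ P, Epi p → ∃ s : P ⟶ X, s ≫ p = 𝟙 P

/-- `P` is Ext-projective in the subcategory `T`. -/
def ExtProjIn (T : Set C) (P : C) : Prop := P ∈ T ∧ ∀ X ∈ T, Ext1Zero P X

/-- The subcategory `a(T)` associated to a torsion class `T`. -/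
def aSet (T : Set C) : Set C :=
  { B | B ∈ T ∧ ∀ Y ∈ T, ∀ g : Y ⟶ B, (kernel g : C) ∈ T }

/-- A subcategory is finitely generated if it is generated by a single object of it. -/
def IsFinGen (T : Set C) : Prop := ∃ U ∈ T, T ⊆ gen {U}

/-- `U` is a generator of the subcategory `T`. -/
def IsGenerator (T : Set C) (U : C) : Prop := U ∈ T ∧ T ⊆ gen {U}

/-- `X` is a subquotient of `M`. -/
def IsSubquotient (X M : C) : Prop := ∃ (N : C) (i : N ⟶ M) (p : N ⟶ X), Mono i ∧ Epi p

/-- The support of `M` is contained in the support of `C0`: every simple subquotient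
(composition factor) of `M` is a composition factor of `C0`. -/
def SuppLE (M C0 : C) : Prop := ∀ S : C, Simple S → IsSubquotient S M → IsSubquotient S C0

/-- A partial tilting object of a hereditary category. -/
def IsPartialTilting (T : C) : Prop := Ext1Zero T T

/-- `T` is a tilting object of the full subcategory `A`: it is self-orthogonal and every
(split) projective object of `A` admits a coresolution `0 ⟶ P ⟶ T' ⟶ T'' ⟶ 0` with
`T', T'' ∈ add T`. For `A` the subcategory of representations supported on `supp T`,
this says exactly that `T` is a tilting `kQ/ann T`-module. -/
def TiltingIn (A : Set C) (T : C) : Prop :=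
  T ∈ A ∧ Ext1Zero T T ∧
    ∀ P : C, SplitProjIn A P →
      ∃ (T' T'' : C) (_ : T' ∈ addSet {T}) (_ : T'' ∈ addSet {T})
        (i : P ⟶ T') (p : T' ⟶ T'') (w : i ≫ p = 0),
        (ShortComplex.mk i p w).ShortExact


/-- `U` is the direct sum of one representative of each isomorphism class of
indecomposable Ext-projective objects of `T`. -/
def IsExtProjSum (T : Set C) (U : C) : Prop :=
  ∃ (n : ℕ) (f : Fin n → C),
    (∀ i, Indec (f i) ∧ ExtProjIn T (f i)) ∧
    (∀ i j, Nonempty (f i ≅ f j) → i = j) ∧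
    (∀ P : C, Indec P → ExtProjIn T P → ∃ i, Nonempty (P ≅ f i)) ∧
    Nonempty (U ≅ ⨁ f)

/-- A basic object: a direct sum of pairwise non-isomorphic indecomposables. -/
def IsBasic (U : C) : Prop :=
  ∃ (n : ℕ) (f : Fin n → C), (∀ i, Indec (f i)) ∧
    (∀ i j, Nonempty (f i ≅ f j) → i = j) ∧ Nonempty (U ≅ ⨁ f)

end Cat

/-- A support tilting object of `rep Q`: partial tilting, and tilting as a
`kQ/ann T`-module, i.e. tilting in the subcategory of all finite-dimensional
representations supported on the support of `T`. -/
def IsSupportTilting {k : Type} [Field k] {Q : FinQuiver} (T : RepC k Q) : Prop :=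
  IsPartialTilting T ∧ TiltingIn { M : RepC k Q | FinDim M ∧ SuppLE M T } T

section Comb

/-- The dimension vector of a representation. -/
def dimVec {k : Type} [Field k] {Q : FinQuiver} (M : RepC k Q) : Q.V → ℤ :=
  fun v => (Module.finrank k (M.obj ((Paths.of Q.V).obj v)) : ℤ)

/-- The Euler form of the quiver `Q`. -/
def euler (Q : FinQuiver) {R : Type} [CommRing R] (α β : Q.V → R) : R :=
  (∑ v : Q.V, α v * β v) - ∑ a : (Σ x : Q.V, Σ y : Q.V, x ⟶ y), α a.1 * β a.2.1

/-- The symmetrized Euler form of the quiver `Q`. -/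
def symEuler (Q : FinQuiver) {R : Type} [CommRing R] (α β : Q.V → R) : R :=
  euler Q α β + euler Q β α

/-- The reflection in the vector `v`: `s_v(w) = w - (v, w)·v`. -/
def reflV (Q : FinQuiver) (v : Q.V → ℤ) : (Q.V → ℤ) → (Q.V → ℤ) :=
  fun w => w - symEuler Q v w • v

/-- The composition (product, written from left to right) of a finite sequence of
linear transformations. -/
def comps (Q : FinQuiver) {m : ℕ} (g : Fin m → ((Q.V → ℤ) → (Q.V → ℤ))) :
    (Q.V → ℤ) → (Q.V → ℤ) :=
  (List.ofFn g).foldr (· ∘ ·) id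

open scoped Classical in
/-- The simple root at a vertex. -/
def simRoot (Q : FinQuiver) (v : Q.V) : Q.V → ℤ := fun w => if w = v then 1 else 0

/-- The simple reflection at a vertex. -/
def sref (Q : FinQuiver) (v : Q.V) : (Q.V → ℤ) → (Q.V → ℤ) := reflV Q (simRoot Q v)

/-- An enumeration of the vertices is compatible with the arrows of `Q` if sources
of arrows come before targets. -/
def OrdCompatible (Q : FinQuiver) (ord : Fin (Fintype.card Q.V) ≃ Q.V) : Prop :=
  ∀ (x y : Q.V), (x ⟶ y) → ord.symm x < ord.symm y

/-- The Coxeter element `cox(Q)`: the product of the simple reflections from left to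
right in an order compatible with the arrows of `Q`. -/
def coxeter (Q : FinQuiver) (ord : Fin (Fintype.card Q.V) ≃ Q.V) :
    (Q.V → ℤ) → (Q.V → ℤ) :=
  comps Q fun i => sref Q (ord i)

/-- The product of the simple reflections indexed by a word (a list of vertices). -/
def wordProd (Q : FinQuiver) (l : List Q.V) : (Q.V → ℤ) → (Q.V → ℤ) :=
  (l.map (sref Q)).foldr (· ∘ ·) id

/-- Membership in the Coxeter group `W` (realized faithfully on the root lattice). -/
def InW (Q : FinQuiver) (w : (Q.V → ℤ) → (Q.V → ℤ)) : Prop :=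
  ∃ l : List Q.V, w = wordProd Q l

/-- The reflections of `W`: the conjugates of the simple reflections. -/
def IsRefl (Q : FinQuiver) (t : (Q.V → ℤ) → (Q.V → ℤ)) : Prop :=
  ∃ (l : List Q.V) (i : Q.V), t = wordProd Q l ∘ sref Q i ∘ wordProd Q l.reverse

/-- The absolute length: the least length of an expression as a product of reflections. -/
def ellT (Q : FinQuiver) (w : (Q.V → ℤ) → (Q.V → ℤ)) : ℕ :=
  sInf { m | ∃ f : Fin m → ((Q.V → ℤ) → (Q.V → ℤ)), (∀ i, IsRefl Q (f i)) ∧ w = comps Q f }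

/-- The absolute order on `W`. -/
def absLe (Q : FinQuiver) : ((Q.V → ℤ) → (Q.V → ℤ)) → ((Q.V → ℤ) → (Q.V → ℤ)) → Prop :=
  Relation.ReflTransGen fun u v => ∃ t, IsRefl Q t ∧ v = u ∘ t ∧ ellT Q v = ellT Q u + 1

/-- The noncrossing partitions `NC_Q`: the interval `[e, cox(Q)]` in absolute order. -/
def NCSet (Q : FinQuiver) (ord : Fin (Fintype.card Q.V) ≃ Q.V) :
    Set ((Q.V → ℤ) → (Q.V → ℤ)) :=
  { w | InW Q w ∧ absLe Q w (coxeter Q ord) }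

/-- `Q` is of finite (Dynkin) type: the symmetrized Euler form is positive definite. -/
def FiniteType (Q : FinQuiver) : Prop :=
  ∀ α : Q.V → ℚ, α ≠ 0 → 0 < symEuler Q α α

/-- `Q` is of affine (extended Dynkin) type: the symmetrized Euler form is positive
semidefinite with nontrivial radical. -/
def AffineType (Q : FinQuiver) : Prop :=
  (∀ α : Q.V → ℚ, 0 ≤ symEuler Q α α) ∧ ∃ α : Q.V → ℚ, α ≠ 0 ∧ symEuler Q α α = 0

end Comb

section Statement18

variable {k : Type} [Field k] {Q : FinQuiver}

/-- A positive root: a nonzero nonnegative integral vector `α` with `(α, α) = 2`. -/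
def IsPosRoot (Q : FinQuiver) (α : Q.V → ℤ) : Prop :=
  (∀ v, 0 ≤ α v) ∧ α ≠ 0 ∧ symEuler Q α α = 2

/-- The length `ℓ_S(w)` of `w` with respect to the simple reflections. -/
def ellS (Q : FinQuiver) (w : (Q.V → ℤ) → (Q.V → ℤ)) : ℕ :=
  sInf { m | ∃ l : List Q.V, l.length = m ∧ w = wordProd Q l }

/-- The inversion set `I(w) = {α ∈ Φ⁺ : w⁻¹(α) < 0}` of `w`. -/
def InvSet (Q : FinQuiver) (w : (Q.V → ℤ) → (Q.V → ℤ)) : Set (Q.V → ℤ) :=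
  { α | IsPosRoot Q α ∧ ∀ l : List Q.V, w = wordProd Q l →
      ∀ v : Q.V, wordProd Q l.reverse α v ≤ 0 }

open scoped Classical in
/-- The word consisting of the simple reflections indexed by `A ⊆ V`, taken in the
order of `c = cox(Q)` prescribed by the enumeration `ord`. -/
def csortBlock (Q : FinQuiver) (ord : Fin (Fintype.card Q.V) ≃ Q.V)
    (A : Finset Q.V) : List Q.V :=
  (List.ofFn fun i => ord i).filter fun v => decide (v ∈ A)

/-- `w` is `c`-sortable for the Coxeter element `c = cox(Q)` determined by `ord`:
it admits a reduced word which is a concatenation `c_{A₁} c_{A₂} ⋯ c_{A_m}` of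
subwords of `c` with nested supports `A₁ ⊇ A₂ ⊇ ⋯ ⊇ A_m`. -/
def CSortable (Q : FinQuiver) (ord : Fin (Fintype.card Q.V) ≃ Q.V)
    (w : (Q.V → ℤ) → (Q.V → ℤ)) : Prop :=
  ∃ (m : ℕ) (A : Fin m → Finset Q.V),
    (∀ i j : Fin m, i ≤ j → A j ⊆ A i) ∧
    w = wordProd Q (List.flatten (List.ofFn fun i => csortBlock Q ord (A i))) ∧
    ellS Q w = ∑ i, (A i).card


section Helpers18

variable {k : Type} [Field k] {Q : FinQuiver}

/-! ### Combinatorics of the forms -/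

section FormBasics

open scoped Classical

def adj (Q : FinQuiver) (i j : Q.V) : ℤ := (Fintype.card (i ⟶ j) : ℤ) + Fintype.card (j ⟶ i)

lemma adj_comm (i j : Q.V) : adj Q i j = adj Q j i := by unfold adj; ring

lemma adj_nonneg (i j : Q.V) : 0 ≤ adj Q i j := by unfold adj; positivity

lemma adj_self (i : Q.V) : adj Q i i = 0 := by
  have : IsEmpty (i ⟶ i) := ⟨fun a => by
    have h := Q.acyclic i (Quiver.Hom.toPath a)
    have h2 := congrArg Quiver.Path.length h
    simp [Quiver.Hom.toPath] at h2⟩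
  simp [adj]

lemma euler_eq {R : Type} [CommRing R] (α β : Q.V → R) :
    euler Q α β = (∑ v, α v * β v) - ∑ i, ∑ j, (Fintype.card (i ⟶ j) : R) * (α i * β j) := by
  unfold euler
  congr 1
  rw [Fintype.sum_sigma]
  refine Finset.sum_congr rfl fun i _ => ?_
  rw [Fintype.sum_sigma]
  refine Finset.sum_congr rfl fun j _ => ?_
  simp

lemma symEuler_eq {R : Type} [CommRing R] (α β : Q.V → R) :
    symEuler Q α β = 2 * (∑ v, α v * β v) - ∑ i, ∑ j, (adj Q i j : R) * (α i * β j) := by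
  unfold symEuler
  rw [euler_eq, euler_eq]
  have h1 : ∑ v, β v * α v = ∑ v, α v * β v := Finset.sum_congr rfl fun v _ => mul_comm _ _
  have h2 : ∑ i, ∑ j, (Fintype.card (i ⟶ j) : R) * (β i * α j)
      = ∑ i, ∑ j, (Fintype.card (j ⟶ i) : R) * (α i * β j) := by
    rw [Finset.sum_comm]
    refine Finset.sum_congr rfl fun i _ => Finset.sum_congr rfl fun j _ => by ring
  have h3 : ∑ i, ∑ j, (adj Q i j : R) * (α i * β j)
      = ∑ i, ∑ j, (Fintype.card (i ⟶ j) : R) * (α i * β j)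
        + ∑ i, ∑ j, (Fintype.card (j ⟶ i) : R) * (α i * β j) := by
    rw [← Finset.sum_add_distrib]
    refine Finset.sum_congr rfl fun i _ => ?_
    rw [← Finset.sum_add_distrib]
    refine Finset.sum_congr rfl fun j _ => by simp [adj]; ring
  rw [h1, h2, h3]; ring

lemma euler_add_left {R : Type} [CommRing R] (a b c : Q.V → R) :
    euler Q (a + b) c = euler Q a c + euler Q b c := by
  unfold euler; simp [add_mul, Finset.sum_add_distrib]; ring
lemma euler_add_right {R : Type} [CommRing R] (a b c : Q.V → R) :
    euler Q a (b + c) = euler Q a b + euler Q a c := by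
  unfold euler; simp [mul_add, Finset.sum_add_distrib]; ring
lemma euler_smul_left {R : Type} [CommRing R] (t : R) (a b : Q.V → R) :
    euler Q (t • a) b = t * euler Q a b := by
  unfold euler; simp [mul_assoc, Finset.mul_sum, mul_sub]
lemma euler_smul_right {R : Type} [CommRing R] (t : R) (a b : Q.V → R) :
    euler Q a (t • b) = t * euler Q a b := by
  unfold euler; simp [mul_left_comm, Finset.mul_sum, mul_sub]

lemma sE_comm {R : Type} [CommRing R] (a b : Q.V → R) : symEuler Q a b = symEuler Q b a := by
  unfold symEuler; ring
lemma sE_add_left {R : Type} [CommRing R] (a b c : Q.V → R) :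
    symEuler Q (a + b) c = symEuler Q a c + symEuler Q b c := by
  unfold symEuler; rw [euler_add_left, euler_add_right]; ring
lemma sE_add_right {R : Type} [CommRing R] (a b c : Q.V → R) :
    symEuler Q a (b + c) = symEuler Q a b + symEuler Q a c := by
  rw [sE_comm, sE_add_left, sE_comm b, sE_comm c]
lemma sE_smul_left {R : Type} [CommRing R] (t : R) (a b : Q.V → R) :
    symEuler Q (t • a) b = t * symEuler Q a b := by
  unfold symEuler; rw [euler_smul_left, euler_smul_right]; ring
lemma sE_smul_right {R : Type} [CommRing R] (t : R) (a b : Q.V → R) :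
    symEuler Q a (t • b) = t * symEuler Q a b := by
  rw [sE_comm, sE_smul_left, sE_comm]
lemma sE_neg_left {R : Type} [CommRing R] (a b : Q.V → R) :
    symEuler Q (-a) b = - symEuler Q a b := by
  have := sE_smul_left (-1 : R) a b
  simpa using this
lemma sE_neg_right {R : Type} [CommRing R] (a b : Q.V → R) :
    symEuler Q a (-b) = - symEuler Q a b := by
  rw [sE_comm, sE_neg_left, sE_comm]
lemma sE_sub_left {R : Type} [CommRing R] (a b c : Q.V → R) :
    symEuler Q (a - b) c = symEuler Q a c - symEuler Q b c := by
  rw [sub_eq_add_neg, sE_add_left, sE_neg_left]; ring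
lemma sE_sub_right {R : Type} [CommRing R] (a b c : Q.V → R) :
    symEuler Q a (b - c) = symEuler Q a b - symEuler Q a c := by
  rw [sub_eq_add_neg, sE_add_right, sE_neg_right]; ring

/-- simple vector over any ring -/
def eV (Q : FinQuiver) (R : Type) [CommRing R] (v : Q.V) : Q.V → R := fun w => if w = v then 1 else 0

lemma simRoot_eq (v : Q.V) : simRoot Q v = eV Q ℤ v := rfl

/-- neighbour sum -/
def nb (Q : FinQuiver) {R : Type} [CommRing R] (x : Q.V) (a : Q.V → R) : R :=
  ∑ j, (adj Q x j : R) * a j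

lemma sE_eV {R : Type} [CommRing R] (v : Q.V) (a : Q.V → R) :
    symEuler Q (eV Q R v) a = 2 * a v - nb Q v a := by
  rw [symEuler_eq]; simp [eV, nb]

lemma sE_sum {R : Type} [CommRing R] (a b : Q.V → R) :
    symEuler Q a b = ∑ v, a v * symEuler Q (eV Q R v) b := by
  simp_rw [sE_eV]
  rw [symEuler_eq]
  simp only [nb, mul_sub, Finset.sum_sub_distrib, Finset.mul_sum]
  congr 1
  · exact Finset.sum_congr rfl fun v _ => by ring
  · exact Finset.sum_congr rfl fun v _ => Finset.sum_congr rfl fun w _ => by ring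

lemma sE_simRoot (v : Q.V) (a : Q.V → ℤ) :
    symEuler Q (simRoot Q v) a = 2 * a v - nb Q v a := by
  rw [simRoot_eq, sE_eV]

lemma nb_simRoot (v : Q.V) : nb Q v (simRoot Q v) = 0 := by
  simp [nb, simRoot, adj_self]

lemma sE_simRoot_self (v : Q.V) : symEuler Q (simRoot Q v) (simRoot Q v) = 2 := by
  rw [sE_simRoot, nb_simRoot]; simp [simRoot]

lemma sE_cast (a b : Q.V → ℤ) :
    symEuler Q (fun v => (a v : ℚ)) (fun v => (b v : ℚ)) = ((symEuler Q a b : ℤ) : ℚ) := by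
  unfold symEuler euler; push_cast; rfl

lemma sE_pos (hft : FiniteType Q) (a : Q.V → ℤ) (ha : a ≠ 0) : 0 < symEuler Q a a := by
  have h := hft (fun v => (a v : ℚ)) (by
    intro h; apply ha; funext v; have := congrFun h v; simpa using this)
  rw [sE_cast] at h
  exact_mod_cast h

lemma sE_ge_two (hft : FiniteType Q) (a : Q.V → ℤ) (ha : a ≠ 0) : 2 ≤ symEuler Q a a := by
  have h := sE_pos hft a ha
  have h2 : symEuler Q a a = 2 * euler Q a a := by unfold symEuler; ring
  omega

lemma root_sign (hft : FiniteType Q) (a : Q.V → ℤ) (ha : symEuler Q a a = 2) :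
    (∀ v, 0 ≤ a v) ∨ (∀ v, a v ≤ 0) := by
  set p : Q.V → ℤ := fun v => max (a v) 0 with hp
  set n : Q.V → ℤ := fun v => max (-(a v)) 0 with hn
  have hpn : a = p - n := by
    funext v; simp only [hp, hn, Pi.sub_apply]
    rcases le_total 0 (a v) with h | h
    · rw [max_eq_left h, max_eq_right (by omega)]; ring
    · rw [max_eq_right h, max_eq_left (by omega)]; ring
  have hcross : symEuler Q p n ≤ 0 := by
    rw [symEuler_eq]
    have h1 : ∑ v, p v * n v = 0 := by
      refine Finset.sum_eq_zero fun v _ => ?_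
      simp only [hp, hn]
      rcases le_total 0 (a v) with h | h
      · rw [max_eq_right (by omega : -(a v) ≤ 0)]; ring
      · rw [max_eq_right h]; ring
    have h2 : 0 ≤ ∑ i, ∑ j, (adj Q i j : ℤ) * (p i * n j) :=
      Finset.sum_nonneg fun i _ => Finset.sum_nonneg fun j _ =>
        mul_nonneg (by exact_mod_cast adj_nonneg i j) (mul_nonneg (le_max_right _ _) (le_max_right _ _))
    rw [h1]; push_cast at *; linarith
  have hexp : symEuler Q a a = symEuler Q p p + symEuler Q n n - 2 * symEuler Q p n := by
    rw [hpn, sE_sub_left, sE_sub_right, sE_sub_right, sE_comm n p]; ring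
  by_cases hp0 : p = 0
  · right; intro v
    have := congrFun hp0 v; simp only [hp, Pi.zero_apply] at this
    exact (max_eq_right_iff.mp this)
  by_cases hn0 : n = 0
  · left; intro v
    have := congrFun hn0 v; simp only [hn, Pi.zero_apply] at this
    have := (max_eq_right_iff.mp this); omega
  have := sE_ge_two hft p hp0
  have := sE_ge_two hft n hn0
  omega

lemma posRoot_simRoot (v : Q.V) : IsPosRoot Q (simRoot Q v) := by
  refine ⟨fun w => ?_, ?_, sE_simRoot_self v⟩
  · unfold simRoot; split <;> simp
  · intro h; have := congrFun h v; simp [simRoot] at this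

/-! simple reflections -/

lemma sref_apply_ne (v w : Q.V) (h : w ≠ v) (a : Q.V → ℤ) : sref Q v a w = a w := by
  simp [sref, reflV, simRoot, h]
lemma sref_apply_self (v : Q.V) (a : Q.V → ℤ) : sref Q v a v = nb Q v a - a v := by
  simp only [sref, reflV, Pi.sub_apply, Pi.smul_apply, sE_simRoot]
  simp [simRoot]; ring
lemma sref_def (v : Q.V) (a : Q.V → ℤ) :
    sref Q v a = a - symEuler Q (simRoot Q v) a • simRoot Q v := rfl

lemma reflV_isom (b : Q.V → ℤ) (hb : symEuler Q b b = 2) (a c : Q.V → ℤ) :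
    symEuler Q (reflV Q b a) (reflV Q b c) = symEuler Q a c := by
  unfold reflV
  rw [sE_sub_left, sE_sub_right, sE_sub_right, sE_smul_left, sE_smul_left, sE_smul_right,
    sE_smul_right, hb, sE_comm a b]; ring
lemma reflV_invol (b : Q.V → ℤ) (hb : symEuler Q b b = 2) (a : Q.V → ℤ) :
    reflV Q b (reflV Q b a) = a := by
  unfold reflV
  rw [sE_sub_right, sE_smul_right, hb]
  funext v; simp; ring
lemma sref_isom (v : Q.V) (a b : Q.V → ℤ) : symEuler Q (sref Q v a) (sref Q v b) = symEuler Q a b :=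
  reflV_isom _ (sE_simRoot_self v) a b
lemma sref_invol (v : Q.V) (a : Q.V → ℤ) : sref Q v (sref Q v a) = a :=
  reflV_invol _ (sE_simRoot_self v) a
lemma sref_add (v : Q.V) (a b : Q.V → ℤ) : sref Q v (a + b) = sref Q v a + sref Q v b := by
  simp only [sref_def, sE_add_right]; funext w; simp; ring
lemma sref_neg (v : Q.V) (a : Q.V → ℤ) : sref Q v (-a) = - sref Q v a := by
  simp only [sref_def, sE_neg_right]; funext w; simp; ring
lemma sref_simRoot (v : Q.V) : sref Q v (simRoot Q v) = - simRoot Q v := by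
  rw [sref_def, sE_simRoot_self]; funext w; simp; ring

lemma posRoot_eq_simRoot (a : Q.V → ℤ) (ha : IsPosRoot Q a) (v : Q.V)
    (h : ∀ w, w ≠ v → a w = 0) : a = simRoot Q v := by
  have h1 : a = (a v) • simRoot Q v := by
    funext w; by_cases hw : w = v
    · subst hw; simp [simRoot]
    · simp [simRoot, hw, h w hw]
  have h2 := ha.2.2
  rw [h1, sE_smul_left, sE_smul_right, sE_simRoot_self] at h2
  have h3 := ha.1 v
  have : a v = 1 := by nlinarith
  rw [h1, this, one_smul]

lemma sref_posRoot (hft : FiniteType Q) (v : Q.V) (a : Q.V → ℤ) (ha : IsPosRoot Q a)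
    (hne : a ≠ simRoot Q v) : IsPosRoot Q (sref Q v a) := by
  have h2 : symEuler Q (sref Q v a) (sref Q v a) = 2 := by rw [sref_isom]; exact ha.2.2
  obtain ⟨w, hw, hw0⟩ : ∃ w, w ≠ v ∧ a w ≠ 0 := by
    by_contra! hcon
    exact hne (posRoot_eq_simRoot a ha v hcon)
  refine ⟨?_, ?_, h2⟩
  · rcases root_sign hft _ h2 with h | h
    · exact h
    · have := h w
      rw [sref_apply_ne v w hw] at this
      have := ha.1 w
      omega
  · intro h; rw [h] at h2; simp [symEuler, euler] at h2

lemma posRoot_eq_of_two_le (hft : FiniteType Q) (a b : Q.V → ℤ) (ha : IsPosRoot Q a)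
    (hb : IsPosRoot Q b) (h : 2 ≤ symEuler Q a b) : a = b := by
  by_contra hne
  have := sE_pos hft (a - b) (sub_ne_zero.mpr hne)
  rw [sE_sub_left, sE_sub_right, sE_sub_right, sE_comm b a, ha.2.2, hb.2.2] at this
  omega

/-! finiteness of roots -/

lemma sE_CS (hft : FiniteType Q) (a b : Q.V → ℚ) :
    symEuler Q a b ^ 2 ≤ symEuler Q a a * symEuler Q b b := by
  have hnn : ∀ c : Q.V → ℚ, 0 ≤ symEuler Q c c := by
    intro c; by_cases hc : c = 0
    · subst hc; simp [symEuler, euler]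
    · exact (hft c hc).le
  by_cases hb : b = 0
  · subst hb; simp [symEuler, euler]
  have hb := hft b hb
  have h := hnn (symEuler Q b b • a - symEuler Q a b • b)
  rw [sE_sub_left, sE_sub_right, sE_sub_right] at h
  simp only [sE_smul_left, sE_smul_right] at h
  rw [sE_comm b a] at h
  have h' : 0 ≤ symEuler Q b b * (symEuler Q a a * symEuler Q b b - symEuler Q a b ^ 2) := by
    nlinarith
  have := nonneg_of_mul_nonneg_right h' hb
  linarith

lemma exists_dual (hft : FiniteType Q) (v : Q.V) :
    ∃ ω : Q.V → ℚ, ∀ b : Q.V → ℚ, symEuler Q b ω = b v := by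
  let φ : (Q.V → ℚ) →ₗ[ℚ] (Q.V → ℚ) :=
    { toFun := fun a w => symEuler Q (eV Q ℚ w) a
      map_add' := fun a b => by funext w; simp [sE_add_right]
      map_smul' := fun t a => by funext w; simp [sE_smul_right] }
  have hinj : Function.Injective φ := by
    rw [← LinearMap.ker_eq_bot, LinearMap.ker_eq_bot']
    intro a ha
    by_contra hne
    have h := hft a hne
    rw [sE_sum] at h
    have : ∀ w, symEuler Q (eV Q ℚ w) a = 0 := fun w => congrFun ha w
    simp [this] at h
  obtain ⟨ω, hω⟩ := (LinearMap.injective_iff_surjective.mp hinj) (eV Q ℚ v)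
  refine ⟨ω, fun b => ?_⟩
  rw [sE_sum]
  have : ∀ w, symEuler Q (eV Q ℚ w) ω = eV Q ℚ v w := fun w => congrFun hω w
  simp [this, eV]

lemma finite_roots (hft : FiniteType Q) : {a : Q.V → ℤ | IsPosRoot Q a}.Finite := by
  choose ω hω using exists_dual hft
  let C : Q.V → ℤ := fun v => ⌈2 * symEuler Q (ω v) (ω v)⌉
  refine (Set.finite_Icc (0 : Q.V → ℤ) C).subset ?_
  intro a ha
  refine ⟨fun v => ha.1 v, fun v => ?_⟩
  have h := sE_CS hft (fun v => (a v : ℚ)) (ω v)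
  rw [hω, sE_cast, ha.2.2] at h
  have h2 : ((a v : ℤ) : ℚ) ≤ (a v : ℚ) ^ 2 := by
    have h0 := ha.1 v
    have : a v ≤ a v ^ 2 := by nlinarith
    exact_mod_cast this
  have h3 : ((a v : ℤ) : ℚ) ≤ 2 * symEuler Q (ω v) (ω v) := by push_cast at h; linarith
  have := h3.trans (Int.le_ceil _)
  exact_mod_cast this

end FormBasics

/-! ### Words, inversion sets -/

section Words

open scoped Classical

lemma wordProd_nil : wordProd Q [] = id := rfl
lemma wordProd_cons (x : Q.V) (l : List Q.V) : wordProd Q (x :: l) = sref Q x ∘ wordProd Q l := rfl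
lemma wordProd_append (l m : List Q.V) :
    wordProd Q (l ++ m) = wordProd Q l ∘ wordProd Q m := by
  induction l with
  | nil => rfl
  | cons x l ih => rw [List.cons_append, wordProd_cons, ih, wordProd_cons]; rfl
lemma wordProd_rev_cons (x : Q.V) (l : List Q.V) (a : Q.V → ℤ) :
    wordProd Q (x :: l).reverse a = wordProd Q l.reverse (sref Q x a) := by
  rw [List.reverse_cons, wordProd_append]; rfl
lemma wordProd_rev (l : List Q.V) (a : Q.V → ℤ) : wordProd Q l.reverse (wordProd Q l a) = a := by
  induction l generalizing a with
  | nil => rfl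
  | cons x l ih =>
    rw [wordProd_rev_cons, wordProd_cons, Function.comp, sref_invol, ih]
lemma wordProd_rev' (l : List Q.V) (a : Q.V → ℤ) : wordProd Q l (wordProd Q l.reverse a) = a := by
  have := wordProd_rev l.reverse a
  rwa [List.reverse_reverse] at this
lemma wordProd_add (l : List Q.V) (a b : Q.V → ℤ) :
    wordProd Q l (a + b) = wordProd Q l a + wordProd Q l b := by
  induction l with
  | nil => rfl
  | cons x l ih => simp only [wordProd_cons, Function.comp, ih, sref_add]
lemma wordProd_neg (l : List Q.V) (a : Q.V → ℤ) :
    wordProd Q l (-a) = - wordProd Q l a := by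
  induction l with
  | nil => rfl
  | cons x l ih => simp only [wordProd_cons, Function.comp, ih, sref_neg]
lemma wordProd_isom (l : List Q.V) (a b : Q.V → ℤ) :
    symEuler Q (wordProd Q l a) (wordProd Q l b) = symEuler Q a b := by
  induction l with
  | nil => rfl
  | cons x l ih => simp only [wordProd_cons, Function.comp, sref_isom, ih]
lemma wordProd_inj (l : List Q.V) : Function.Injective (wordProd Q l) :=
  Function.LeftInverse.injective (wordProd_rev l)

def inv (l : List Q.V) : Set (Q.V → ℤ) :=
  {a | IsPosRoot Q a ∧ ∀ v, wordProd Q l.reverse a v ≤ 0}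

lemma rev_eq_of_eq {l m : List Q.V} (h : wordProd Q l = wordProd Q m) :
    wordProd Q l.reverse = wordProd Q m.reverse := by
  funext a
  apply wordProd_inj l
  rw [wordProd_rev', h, wordProd_rev']

lemma InvSet_eq (l : List Q.V) : InvSet Q (wordProd Q l) = inv l := by
  ext a
  constructor
  · rintro ⟨h1, h2⟩; exact ⟨h1, h2 l rfl⟩
  · rintro ⟨h1, h2⟩; refine ⟨h1, fun m hm => ?_⟩
    rw [← rev_eq_of_eq hm]; exact h2

lemma inv_congr {l m : List Q.V} (h : wordProd Q l = wordProd Q m) : inv l = inv m := by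
  rw [← InvSet_eq, ← InvSet_eq, h]

lemma inv_nil : inv (Q := Q) [] = ∅ := by
  ext a
  simp only [Set.mem_empty_iff_false, iff_false]
  rintro ⟨h1, h2⟩
  apply h1.2.1; funext v
  exact le_antisymm (h2 v) (h1.1 v)

lemma mem_inv_cons_ne (hft : FiniteType Q) (x : Q.V) (l : List Q.V) (a : Q.V → ℤ)
    (ha : IsPosRoot Q a) (hne : a ≠ simRoot Q x) : a ∈ inv (x :: l) ↔ sref Q x a ∈ inv l := by
  simp only [inv, Set.mem_ofPred_eq, wordProd_rev_cons]
  have := sref_posRoot hft x a ha hne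
  tauto

lemma mem_inv_cons_self (hft : FiniteType Q) (x : Q.V) (l : List Q.V) :
    simRoot Q x ∈ inv (x :: l) ↔ simRoot Q x ∉ inv l := by
  simp only [inv, Set.mem_ofPred_eq, wordProd_rev_cons, sref_simRoot, wordProd_neg]
  have h2 : symEuler Q (wordProd Q l.reverse (simRoot Q x)) (wordProd Q l.reverse (simRoot Q x)) = 2 := by
    rw [wordProd_isom, sE_simRoot_self]
  have h0 : wordProd Q l.reverse (simRoot Q x) ≠ 0 := by
    intro h; rw [h] at h2; simp [symEuler, euler] at h2
  have hp := posRoot_simRoot (Q := Q) x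
  constructor
  · rintro ⟨_, h⟩ ⟨_, h'⟩
    apply h0; funext v
    have := h v; have := h' v; simp at *; omega
  · intro h
    refine ⟨hp, fun v => ?_⟩
    rcases root_sign hft _ h2 with h3 | h3
    · simpa using h3 v
    · exact absurd ⟨hp, h3⟩ h

lemma sref_ne_simRoot {x : Q.V} {a : Q.V → ℤ} (ha : IsPosRoot Q a) : sref Q x a ≠ simRoot Q x := by
  intro h
  have h2 : a = - simRoot Q x := by rw [← sref_simRoot, ← h, sref_invol]
  have := ha.1 x
  rw [h2] at this
  simp [simRoot] at this

lemma inv_finite (hft : FiniteType Q) (l : List Q.V) : (inv l).Finite :=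
  (finite_roots hft).subset fun _ h => h.1

lemma inv_ncard_le (hft : FiniteType Q) (l : List Q.V) : (inv l).ncard ≤ l.length := by
  induction l with
  | nil => simp [inv_nil]
  | cons x l ih =>
    have hsub : inv (x :: l) ⊆ insert (simRoot Q x) (sref Q x '' inv l) := by
      intro a ha
      by_cases hne : a = simRoot Q x
      · exact Or.inl hne
      · right
        exact ⟨sref Q x a, (mem_inv_cons_ne hft x l a ha.1 hne).mp ha, sref_invol x a⟩
    have hfin := ((inv_finite hft l).image (sref Q x))
    calc _ ≤ _ := Set.ncard_le_ncard hsub (hfin.insert _)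
      _ ≤ (sref Q x '' inv l).ncard + 1 := Set.ncard_insert_le _ _
      _ ≤ (inv l).ncard + 1 := by
        have := Set.ncard_image_le (f := sref Q x) (inv_finite hft l); omega
      _ ≤ _ := by simp; omega

lemma reflV_conj (x : Q.V) (b a : Q.V → ℤ) :
    reflV Q b (sref Q x a) = sref Q x (reflV Q (sref Q x b) a) := by
  have h : symEuler Q b (sref Q x a) = symEuler Q (sref Q x b) a := by
    rw [← sref_isom x b, sref_invol]
  unfold reflV
  rw [h, sub_eq_add_neg, sub_eq_add_neg, sref_add, sref_neg]
  congr 2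
  have : ∀ (t : ℤ) (c : Q.V → ℤ), sref Q x (t • c) = t • sref Q x c := by
    intro t c; simp only [sref_def, sE_smul_right]; funext w; simp; ring
  rw [this, sref_invol]

lemma exchange (hft : FiniteType Q) (l : List Q.V) (b : Q.V → ℤ) (hb : b ∈ inv l) :
    ∃ m : List Q.V, m.length + 1 = l.length ∧ wordProd Q m = reflV Q b ∘ wordProd Q l := by
  induction l generalizing b with
  | nil => rw [inv_nil] at hb; exact hb.elim
  | cons y l ih =>
    by_cases hby : b = simRoot Q y
    · subst hby
      refine ⟨l, by simp, ?_⟩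
      funext a
      exact (sref_invol y _).symm
    · obtain ⟨m, hm, hm2⟩ := ih _ ((mem_inv_cons_ne hft y l b hb.1 hby).mp hb)
      refine ⟨y :: m, by simp [hm], ?_⟩
      funext a
      simp only [wordProd_cons, Function.comp, reflV_conj, hm2]

def Red (l : List Q.V) : Prop := ∀ m : List Q.V, wordProd Q m = wordProd Q l → l.length ≤ m.length

lemma ellS_le (l : List Q.V) : ellS Q (wordProd Q l) ≤ l.length :=
  Nat.sInf_le ⟨l, rfl, rfl⟩

lemma ellS_spec (l : List Q.V) : ∃ m : List Q.V, m.length = ellS Q (wordProd Q l) ∧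
    wordProd Q l = wordProd Q m :=
  Nat.sInf_mem (s := {n | ∃ m : List Q.V, m.length = n ∧ wordProd Q l = wordProd Q m})
    ⟨l.length, l, rfl, rfl⟩

lemma red_iff (l : List Q.V) : ellS Q (wordProd Q l) = l.length ↔ Red l := by
  constructor
  · intro h m hm
    rw [← h, ← hm]; exact ellS_le m
  · intro h
    obtain ⟨m, h1, h2⟩ := ellS_spec l
    have := h m h2.symm
    have := ellS_le l
    omega

lemma exists_red (l : List Q.V) : ∃ m : List Q.V, Red m ∧ wordProd Q m = wordProd Q l := by
  obtain ⟨m, h1, h2⟩ := ellS_spec l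
  refine ⟨m, ?_, h2.symm⟩
  rw [← red_iff, ← h2, h1]

lemma red_tail {x : Q.V} {l : List Q.V} (h : Red (x :: l)) : Red l := by
  intro m hm
  have := h (x :: m) (by rw [wordProd_cons, wordProd_cons, hm])
  simpa using this

lemma red_head (hft : FiniteType Q) {x : Q.V} {l : List Q.V} (h : Red (x :: l)) :
    simRoot Q x ∉ inv l := by
  intro hx
  obtain ⟨m, h1, h2⟩ := exchange hft l _ hx
  have := h m h2
  simp at this; omega

lemma red_of_ncard (hft : FiniteType Q) {l : List Q.V} (h : l.length ≤ (inv l).ncard) : Red l := by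
  intro m hm
  have := inv_ncard_le hft m
  rw [inv_congr hm] at this
  omega

lemma inv_inj_red (hft : FiniteType Q) (l : List Q.V) (hl : Red l) (m : List Q.V)
    (h : inv l = inv m) : wordProd Q l = wordProd Q m := by
  induction l generalizing m with
  | nil =>
    obtain ⟨m', h1, h2⟩ := exists_red m
    rw [← inv_congr h2, inv_nil] at h
    rw [← h2]
    cases m' with
    | nil => rfl
    | cons x m'' =>
      have := (mem_inv_cons_self hft x m'').mpr (red_head hft h1)
      rw [← h] at this; exact this.elim
  | cons x l ih =>
    have hx := (mem_inv_cons_self hft x l).mpr (red_head hft hl)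
    have key : inv l = inv (x :: m) := by
      ext a
      by_cases hne : a = simRoot Q x
      · subst hne
        rw [mem_inv_cons_self hft, ← h]
        exact ⟨fun h' => absurd h' (red_head hft hl), fun h' => absurd hx h'⟩
      · constructor
        · intro ha
          rw [mem_inv_cons_ne hft x m a ha.1 hne, ← h,
            mem_inv_cons_ne hft x l _ (sref_posRoot hft x a ha.1 hne) (sref_ne_simRoot ha.1), sref_invol]
          exact ha
        · intro ha
          have ha1 := ha.1
          rw [mem_inv_cons_ne hft x m a ha.1 hne, ← h,
            mem_inv_cons_ne hft x l _ (sref_posRoot hft x a ha1 hne) (sref_ne_simRoot ha1), sref_invol] at ha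
          exact ha
    have h2 := ih (red_tail hl) _ key
    rw [wordProd_cons, h2]
    funext a; exact sref_invol x _

lemma inv_inj (hft : FiniteType Q) (l m : List Q.V) (h : inv l = inv m) :
    wordProd Q l = wordProd Q m := by
  obtain ⟨l', h1, h2⟩ := exists_red l
  rw [← h2]
  exact inv_inj_red hft l' h1 m (by rw [inv_congr h2, h])

/-! Fixed vectors of Coxeter elements -/

lemma wordProd_apply_notMem (l : List Q.V) (a : Q.V → ℤ) (v : Q.V) (hv : v ∉ l) :
    wordProd Q l a v = a v := by
  induction l with
  | nil => rfl
  | cons x l ih =>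
    simp only [List.mem_cons, not_or] at hv
    rw [wordProd_cons, Function.comp, sref_apply_ne x v hv.1, ih hv.2]

lemma cox_fixed (l : List Q.V) (hl : l.Nodup) (a : Q.V → ℤ) (h : wordProd Q l a = a) :
    ∀ x ∈ l, symEuler Q (simRoot Q x) a = 0 := by
  induction l with
  | nil => simp
  | cons x l ih =>
    rw [List.nodup_cons] at hl
    have h1 : wordProd Q l a = sref Q x a := by
      rw [← sref_invol x (wordProd Q l a)]
      exact congrArg _ h
    have h2 : wordProd Q l a = a := by
      funext w
      by_cases hw : w = x
      · subst hw; exact wordProd_apply_notMem l a w hl.1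
      · rw [h1, sref_apply_ne x w hw]
    intro y hy
    rcases List.mem_cons.mp hy with rfl | hy
    · rw [h2, sref_def] at h1
      have := congrFun h1 y
      simp [simRoot] at this
      omega
    · exact ih hl.2 h2 y hy

lemma cox_no_fixed (hft : FiniteType Q) (l : List Q.V) (hl : l.Nodup) (hall : ∀ v, v ∈ l)
    (a : Q.V → ℤ) (h : wordProd Q l a = a) : a = 0 := by
  by_contra hne
  have h1 := sE_pos hft a hne
  rw [sE_sum] at h1
  have : ∀ v, symEuler Q (eV Q ℤ v) a = 0 := fun v => cox_fixed l hl a h v (hall v)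
  simp [this] at h1

/-- no root stays positive forever -/
lemma not_forever_pos (hft : FiniteType Q) (l : List Q.V) (hl : l.Nodup) (hall : ∀ v, v ∈ l)
    (a : Q.V → ℤ) (h : ∀ n : ℕ, IsPosRoot Q ((wordProd Q l)^[n] a)) : False := by
  set c := wordProd Q l with hc
  have hinj : Function.Injective c := wordProd_inj l
  have hfin := finite_roots hft
  have hni : ¬ Function.Injective (fun n : ℕ => c^[n] a) := by
    intro hi
    exact Set.infinite_of_injective_forall_mem hi h hfin
  simp only [Function.Injective, not_forall] at hni
  obtain ⟨i, j, hij, hne⟩ := hni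
  wlog hlt : i < j generalizing i j
  · exact this j i hij.symm (Ne.symm hne) (by omega)
  obtain ⟨d, rfl⟩ := Nat.exists_eq_add_of_lt hlt
  have hper : c^[d + 1] a = a := by
    have h1 : c^[i] (c^[d+1] a) = c^[i] a := by
      rw [← Function.iterate_add_apply]; exact hij.symm
    exact (hinj.iterate i) h1
  set s := ∑ n ∈ Finset.range (d + 1), c^[n] a with hs
  have hcs : ∀ N : ℕ, c (∑ n ∈ Finset.range N, c^[n] a) = ∑ n ∈ Finset.range N, c^[n+1] a := by
    intro N
    induction N with
    | zero =>
      have := wordProd_add (Q := Q) l 0 0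
      simpa using this
    | succ N ih =>
      rw [Finset.sum_range_succ, Finset.sum_range_succ, hc, wordProd_add, ← hc, ih,
        Function.iterate_succ_apply']
  have hfix : c s = s := by
    rw [hs, hcs, Finset.sum_range_succ, hper, Finset.sum_range_succ' (fun n => c^[n] a)]
    rfl
  have hs0 := cox_no_fixed hft l hl hall s hfix
  have ha := h 0
  apply ha.2.1
  funext v
  have hsv : ∑ n ∈ Finset.range (d+1), (c^[n] a) v = 0 := by
    have := congrFun hs0 v
    rw [hs] at this; simpa using this
  have := (Finset.sum_eq_zero_iff_of_nonneg (fun n _ => (h n).1 v)).mp hsv 0 (by simp)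
  simpa using this

end Words

/-! ### Euler forms attached to orderings, closed sets -/

section Orders

open scoped Classical

def eu (pos : Q.V → ℕ) (a b : Q.V → ℤ) : ℤ :=
  (∑ v, a v * b v) - ∑ i, ∑ j, if pos i < pos j then adj Q i j * (a i * b j) else 0

lemma eu_add_left (pos : Q.V → ℕ) (a b c : Q.V → ℤ) :
    eu pos (a + b) c = eu pos a c + eu pos b c := by
  unfold eu
  have : ∀ i j, (if pos i < pos j then adj Q i j * ((a + b) i * c j) else 0)
      = (if pos i < pos j then adj Q i j * (a i * c j) else 0)
        + (if pos i < pos j then adj Q i j * (b i * c j) else 0) := by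
    intro i j; split <;> simp; ring
  simp_rw [this]
  simp [add_mul, Finset.sum_add_distrib]; ring
lemma eu_add_right (pos : Q.V → ℕ) (a b c : Q.V → ℤ) :
    eu pos a (b + c) = eu pos a b + eu pos a c := by
  unfold eu
  have : ∀ i j, (if pos i < pos j then adj Q i j * (a i * (b + c) j) else 0)
      = (if pos i < pos j then adj Q i j * (a i * b j) else 0)
        + (if pos i < pos j then adj Q i j * (a i * c j) else 0) := by
    intro i j; split <;> simp; ring
  simp_rw [this]
  simp [mul_add, Finset.sum_add_distrib]; ring
lemma eu_smul_left (pos : Q.V → ℕ) (t : ℤ) (a b : Q.V → ℤ) :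
    eu pos (t • a) b = t * eu pos a b := by
  unfold eu
  simp only [mul_sub, Finset.mul_sum]
  congr 1
  · exact Finset.sum_congr rfl fun v _ => by simp; ring
  · refine Finset.sum_congr rfl fun v _ => Finset.sum_congr rfl fun w _ => ?_
    split <;> simp; ring
lemma eu_smul_right (pos : Q.V → ℕ) (t : ℤ) (a b : Q.V → ℤ) :
    eu pos a (t • b) = t * eu pos a b := by
  unfold eu
  simp only [mul_sub, Finset.mul_sum]
  congr 1
  · exact Finset.sum_congr rfl fun v _ => by simp; ring
  · refine Finset.sum_congr rfl fun v _ => Finset.sum_congr rfl fun w _ => ?_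
    split <;> simp; ring
lemma eu_neg_left (pos : Q.V → ℕ) (a b : Q.V → ℤ) : eu pos (-a) b = - eu pos a b := by
  have := eu_smul_left pos (-1) a b; simpa using this
lemma eu_neg_right (pos : Q.V → ℕ) (a b : Q.V → ℤ) : eu pos a (-b) = - eu pos a b := by
  have := eu_smul_right pos (-1) a b; simpa using this
lemma eu_sub_left (pos : Q.V → ℕ) (a b c : Q.V → ℤ) :
    eu pos (a - b) c = eu pos a c - eu pos b c := by
  rw [sub_eq_add_neg, eu_add_left, eu_neg_left]; ring
lemma eu_sub_right (pos : Q.V → ℕ) (a b c : Q.V → ℤ) :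
    eu pos a (b - c) = eu pos a b - eu pos a c := by
  rw [sub_eq_add_neg, eu_add_right, eu_neg_right]; ring

lemma eu_sym (pos : Q.V → ℕ) (hpos : Function.Injective pos) (a b : Q.V → ℤ) :
    eu pos a b + eu pos b a = symEuler Q a b := by
  rw [symEuler_eq]
  unfold eu
  have h1 : ∑ v, b v * a v = ∑ v, a v * b v := Finset.sum_congr rfl fun v _ => mul_comm _ _
  have h2 : ∑ i, ∑ j, (if pos i < pos j then adj Q i j * (b i * a j) else 0)
      = ∑ i, ∑ j, (if pos j < pos i then adj Q i j * (a i * b j) else 0) := by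
    rw [Finset.sum_comm]
    refine Finset.sum_congr rfl fun i _ => Finset.sum_congr rfl fun j _ => ?_
    rw [adj_comm j i, mul_comm (b j)]
  have h3 : ∑ i, ∑ j, ((adj Q i j : ℤ) : ℤ) * (a i * b j)
      = ∑ i, ∑ j, (if pos i < pos j then adj Q i j * (a i * b j) else 0)
        + ∑ i, ∑ j, (if pos j < pos i then adj Q i j * (a i * b j) else 0) := by
    rw [← Finset.sum_add_distrib]
    refine Finset.sum_congr rfl fun i _ => ?_
    rw [← Finset.sum_add_distrib]
    refine Finset.sum_congr rfl fun j _ => ?_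
    rcases lt_trichotomy (pos i) (pos j) with h | h | h
    · simp [h, h.le]
    · rw [hpos h]; simp [adj_self]
    · simp [h, h.le]
  rw [h1, h2]
  simp only [Int.cast_id] at h3 ⊢
  rw [h3]; ring

lemma eu_self (pos : Q.V → ℕ) (hpos : Function.Injective pos) (a : Q.V → ℤ) (ha : IsPosRoot Q a) :
    eu pos a a = 1 := by
  have := eu_sym pos hpos a a
  rw [ha.2.2] at this; omega

def MinOn (pos : Q.V → ℕ) (x : Q.V) (L : List Q.V) : Prop := ∀ y ∈ L, y ≠ x → pos x < pos y

def Supp (L : List Q.V) (a : Q.V → ℤ) : Prop := ∀ v, v ∉ L → a v = 0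

lemma eu_min_right {pos : Q.V → ℕ} {x : Q.V} {L : List Q.V} (hm : MinOn pos x L) {b : Q.V → ℤ}
    (hb : Supp L b) : eu pos b (simRoot Q x) = b x := by
  unfold eu
  have h : ∑ i, ∑ j, (if pos i < pos j then adj Q i j * (b i * simRoot Q x j) else 0) = 0 := by
    refine Finset.sum_eq_zero fun i _ => Finset.sum_eq_zero fun j _ => ?_
    by_cases hj : j = x
    · subst hj
      by_cases hi : i ∈ L
      · by_cases hij : i = j
        · simp [hij]
        · have := hm i hi hij
          rw [if_neg (by omega)]
      · simp [hb i hi]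
    · simp [simRoot, hj]
  rw [h]; simp [simRoot]

lemma eu_min_left {pos : Q.V → ℕ} {x : Q.V} {L : List Q.V} (hm : MinOn pos x L) {b : Q.V → ℤ}
    (hb : Supp L b) : eu pos (simRoot Q x) b = b x - nb Q x b := by
  unfold eu nb
  congr 1
  · simp [simRoot]
  · rw [Finset.sum_eq_single x]
    · refine Finset.sum_congr rfl fun j _ => ?_
      by_cases hj : j ∈ L
      · by_cases hjx : j = x
        · subst hjx; simp [adj_self]
        · rw [if_pos (hm j hj hjx)]; simp [simRoot]
      · simp [hb j hj]
    · intro i _ hi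
      refine Finset.sum_eq_zero fun j _ => ?_
      simp [simRoot, hi]
    · simp

/-- data of a rotation at `x` -/
structure Rot (pos pos' : Q.V → ℕ) (x : Q.V) (L : List Q.V) : Prop where
  mem : x ∈ L
  min : ∀ y ∈ L, y ≠ x → pos x < pos y
  max : ∀ y ∈ L, y ≠ x → pos' y < pos' x
  oth : ∀ y ∈ L, ∀ z ∈ L, y ≠ x → z ≠ x → (pos y < pos z ↔ pos' y < pos' z)

lemma eu_rot {pos pos' : Q.V → ℕ} {x : Q.V} {L : List Q.V} (hr : Rot pos pos' x L)
    {a b : Q.V → ℤ} (ha : Supp L a) (hb : Supp L b) :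
    eu pos' a b = eu pos a b + a x * nb Q x b - b x * nb Q x a := by
  have h1 : a x * nb Q x b = ∑ i, ∑ j, if i = x then adj Q i j * (a i * b j) else 0 := by
    rw [Finset.sum_eq_single x]
    · simp only [nb, if_true, Finset.mul_sum]
      exact Finset.sum_congr rfl fun j _ => by push_cast; ring
    · intro i _ hi; simp [hi]
    · simp
  have h2 : b x * nb Q x a = ∑ i, ∑ j, if j = x then adj Q i j * (a i * b j) else 0 := by
    rw [Finset.sum_comm, Finset.sum_eq_single x]
    · simp only [nb, if_true, Finset.mul_sum]
      exact Finset.sum_congr rfl fun j _ => by rw [adj_comm j x]; push_cast; ring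
    · intro i _ hi; simp [hi]
    · simp
  have h3 : ∑ i, ∑ j, (if pos i < pos j then adj Q i j * (a i * b j) else 0)
      + ∑ i, ∑ j, (if j = x then adj Q i j * (a i * b j) else 0)
      = ∑ i, ∑ j, (if pos' i < pos' j then adj Q i j * (a i * b j) else 0)
        + ∑ i, ∑ j, (if i = x then adj Q i j * (a i * b j) else 0) := by
    rw [← Finset.sum_add_distrib, ← Finset.sum_add_distrib]
    refine Finset.sum_congr rfl fun i _ => ?_
    rw [← Finset.sum_add_distrib, ← Finset.sum_add_distrib]
    refine Finset.sum_congr rfl fun j _ => ?_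
    by_cases hi : i ∈ L
    swap
    · simp [ha i hi]
    by_cases hj : j ∈ L
    swap
    · simp [hb j hj]
    by_cases hix : i = x
    · by_cases hjx : j = x
      · subst hix; subst hjx; simp [adj_self]
      · subst hix
        have e1 := hr.min j hj hjx
        have e2 := hr.max j hj hjx
        rw [if_pos e1, if_neg hjx, if_neg (by omega), if_pos rfl]; ring
    · by_cases hjx : j = x
      · subst hjx
        have e1 := hr.min i hi hix
        have e2 := hr.max i hi hix
        rw [if_neg (by omega), if_pos rfl, if_pos e2, if_neg hix]; ring
      · have e1 := hr.oth i hi j hj hix hjx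
        by_cases h : pos i < pos j
        · rw [if_pos h, if_pos (e1.mp h), if_neg hjx, if_neg hix]
        · rw [if_neg h, if_neg (fun h' => h (e1.mpr h')), if_neg hjx, if_neg hix]
  unfold eu
  rw [h1, h2]
  linarith

lemma supp_simRoot {x : Q.V} {L : List Q.V} (hx : x ∈ L) : Supp L (simRoot Q x) := by
  intro v hv
  have : v ≠ x := fun h => hv (h ▸ hx)
  simp [simRoot, this]

lemma supp_sref {x : Q.V} {L : List Q.V} (hx : x ∈ L) {a : Q.V → ℤ} (ha : Supp L a) :
    Supp L (sref Q x a) := by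
  intro v hv
  have : v ≠ x := fun h => hv (h ▸ hx)
  rw [sref_apply_ne x v this, ha v hv]

lemma nb_sref (x : Q.V) (a : Q.V → ℤ) : nb Q x (sref Q x a) = nb Q x a := by
  unfold nb
  refine Finset.sum_congr rfl fun j _ => ?_
  by_cases h : j = x
  · subst h; simp [adj_self]
  · rw [sref_apply_ne x j h]

lemma eu_reflect {pos pos' : Q.V → ℕ} {x : Q.V} {L : List Q.V} (hr : Rot pos pos' x L)
    {a b : Q.V → ℤ} (ha : Supp L a) (hb : Supp L b) :
    eu pos' (sref Q x a) (sref Q x b) = eu pos a b := by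
  rw [eu_rot hr (supp_sref hr.mem ha) (supp_sref hr.mem hb), nb_sref, nb_sref, sref_apply_self,
    sref_apply_self, sref_def, sref_def, eu_sub_left, eu_sub_right, eu_sub_right, eu_smul_left,
    eu_smul_left, eu_smul_right, eu_smul_right, eu_min_right hr.min ha, eu_min_left hr.min hb,
    eu_min_right hr.min (supp_simRoot hr.mem), sE_simRoot, sE_simRoot]
  have : simRoot Q x x = 1 := by simp [simRoot]
  rw [this]; ring

/-- orderings sorting a list -/
def Sorted (pos : Q.V → ℕ) (L : List Q.V) : Prop := L.Pairwise fun i j => pos i < pos j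

lemma Sorted.nodup {pos : Q.V → ℕ} {L : List Q.V} (h : Sorted pos L) : L.Nodup :=
  h.imp fun h e => by rw [e] at h; exact lt_irrefl _ h

def rotp (pos : Q.V → ℕ) (x : Q.V) : Q.V → ℕ := Function.update pos x (1 + ∑ v, pos v)

lemma le_sum_pos (pos : Q.V → ℕ) (v : Q.V) : pos v ≤ ∑ v, pos v :=
  Finset.single_le_sum (f := pos) (fun _ _ => Nat.zero_le _) (Finset.mem_univ v)

lemma rotp_inj {pos : Q.V → ℕ} (h : Function.Injective pos) (x : Q.V) :
    Function.Injective (rotp pos x) := by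
  intro i j hij
  unfold rotp at hij
  have hi := le_sum_pos pos i
  have hj := le_sum_pos pos j
  by_cases h1 : i = x <;> by_cases h2 : j = x
  · rw [h1, h2]
  · rw [h1, Function.update_self, Function.update_of_ne h2] at hij; omega
  · rw [h2, Function.update_self, Function.update_of_ne h1] at hij; omega
  · rw [Function.update_of_ne h1, Function.update_of_ne h2] at hij; exact h hij

lemma rotp_rot {pos : Q.V → ℕ} {x : Q.V} {L : List Q.V} (h : Sorted pos (x :: L)) :
    Rot pos (rotp pos x) x (x :: L) where
  mem := by simp
  min := by
    intro y hy hne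
    rcases List.mem_cons.mp hy with rfl | hy
    · exact absurd rfl hne
    · exact (List.pairwise_cons.mp h).1 y hy
  max := by
    intro y hy hne
    have := le_sum_pos pos y
    unfold rotp
    rw [Function.update_self, Function.update_of_ne hne]; omega
  oth := by
    intro y _ z _ hy hz
    unfold rotp
    rw [Function.update_of_ne hy, Function.update_of_ne hz]

lemma rotp_sorted {pos : Q.V → ℕ} {x : Q.V} {L : List Q.V} (h : Sorted pos (x :: L)) :
    Sorted (rotp pos x) (L ++ [x]) := by
  have hn := h.nodup
  rw [List.nodup_cons] at hn
  have hr := rotp_rot h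
  unfold Sorted at h ⊢
  rw [List.pairwise_cons] at h
  rw [List.pairwise_append]
  refine ⟨?_, by simp, ?_⟩
  · refine h.2.imp_of_mem fun {a b} ha hb hab => ?_
    exact (hr.oth a (by simp [ha]) b (by simp [hb]) (fun e => hn.1 (e ▸ ha)) (fun e => hn.1 (e ▸ hb))).mp hab
  · intro a ha b hb
    rw [List.mem_singleton] at hb; subst hb
    exact hr.max a (by simp [ha]) (fun e => hn.1 (e ▸ ha))

/-! acyclicity -/

structure Cyc (F : List Q.V) (a b c : Q.V → ℤ) : Prop where
  ra : IsPosRoot Q a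
  rb : IsPosRoot Q b
  rc : IsPosRoot Q c
  ex : ∃ pos : Q.V → ℕ, Sorted pos F ∧ eu pos a b < 0 ∧ eu pos b c < 0 ∧ eu pos c a < 0

lemma cyc_step (hft : FiniteType Q) {x : Q.V} {F : List Q.V} (hall : ∀ v, v ∈ x :: F)
    {a b c : Q.V → ℤ} (h : Cyc (x :: F) a b c) :
    Cyc (F ++ [x]) (sref Q x a) (sref Q x b) (sref Q x c) := by
  obtain ⟨ra, rb, rc, pos, hs, h1, h2, h3⟩ := h
  have hr := rotp_rot hs
  have sup : ∀ d : Q.V → ℤ, Supp (x :: F) d := fun d v hv => absurd (hall v) hv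
  have ne : ∀ d e : Q.V → ℤ, IsPosRoot Q d → eu pos d e < 0 → e ≠ simRoot Q x := by
    intro d e hd hde he
    rw [he, eu_min_right hr.min (sup d)] at hde
    have := hd.1 x
    omega
  refine ⟨sref_posRoot hft x a ra (ne c a rc h3), sref_posRoot hft x b rb (ne a b ra h1),
    sref_posRoot hft x c rc (ne b c rb h2), rotp pos x, rotp_sorted hs, ?_, ?_, ?_⟩
  all_goals rw [eu_reflect hr (sup _) (sup _)]; assumption

lemma cyc_pass (hft : FiniteType Q) (P R : List Q.V) (hall : ∀ v, v ∈ P ++ R)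
    {a b c : Q.V → ℤ} (h : Cyc (P ++ R) a b c) :
    Cyc (R ++ P) (wordProd Q P.reverse a) (wordProd Q P.reverse b) (wordProd Q P.reverse c) := by
  induction P generalizing R a b c with
  | nil => simpa [wordProd_nil] using h
  | cons x P ih =>
    have h1 := cyc_step hft hall h
    rw [wordProd_rev_cons, wordProd_rev_cons, wordProd_rev_cons]
    have h2 := ih (R ++ [x]) (by intro v; have := hall v; simp at this ⊢; tauto) (by simpa using h1)
    simpa using h2

lemma no_cyc (hft : FiniteType Q) (F : List Q.V) (hall : ∀ v, v ∈ F) {a b c : Q.V → ℤ}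
    (h : Cyc F a b c) : False := by
  have hn : F.Nodup := by
    obtain ⟨_, _, _, pos, hs, _⟩ := h
    exact hs.nodup
  have key : ∀ n : ℕ, ∃ b' c', Cyc F ((wordProd Q F.reverse)^[n] a) b' c' := by
    intro n
    induction n with
    | zero => exact ⟨b, c, h⟩
    | succ n ih =>
      obtain ⟨b', c', h'⟩ := ih
      rw [Function.iterate_succ_apply']
      have := cyc_pass hft F [] (by simpa using hall) (by simpa using h')
      exact ⟨_, _, by simpa using this⟩
  refine not_forever_pos hft F.reverse (List.nodup_reverse.mpr hn) (by simpa using hall) a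
    fun n => ?_
  obtain ⟨_, _, h'⟩ := key n
  exact h'.ra

lemma exists_sorted (pos : Q.V → ℕ) (hpos : Function.Injective pos) :
    ∃ F : List Q.V, Sorted pos F ∧ ∀ v, v ∈ F := by
  let r : Q.V → Q.V → Prop := fun i j => pos i ≤ pos j
  have : IsTrans Q.V r := ⟨fun a b c h1 h2 => le_trans (α := ℕ) h1 h2⟩
  have : Std.Antisymm r := ⟨fun a b h1 h2 => hpos (le_antisymm h1 h2)⟩
  have : Std.Total r := ⟨fun a b => le_total (pos a) (pos b)⟩
  refine ⟨(Finset.univ : Finset Q.V).sort r, ?_, fun v => by simp⟩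
  have h1 : ((Finset.univ : Finset Q.V).sort r).Pairwise r := Finset.pairwise_sort _ _
  have h2 : ((Finset.univ : Finset Q.V).sort r).Nodup := Finset.sort_nodup _ _
  exact (h1.and h2).imp fun {a b} ⟨h, hne⟩ => lt_of_le_of_ne h fun e => hne (hpos e)

lemma eu_acyclic (hft : FiniteType Q) (pos : Q.V → ℕ) (hpos : Function.Injective pos)
    {a b c : Q.V → ℤ} (ha : IsPosRoot Q a) (hb : IsPosRoot Q b) (hc : IsPosRoot Q c)
    (h1 : eu pos a b < 0) (h2 : eu pos b c < 0) (h3 : eu pos c a < 0) : False := by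
  obtain ⟨F, hF, hall⟩ := exists_sorted pos hpos
  exact no_cyc hft F hall ⟨ha, hb, hc, pos, hF, h1, h2, h3⟩

end Orders

/-! ### Closed sets of roots and sorting words -/

section ClosedSets

open scoped Classical

def Phi (L : List Q.V) (a : Q.V → ℤ) : Prop := IsPosRoot Q a ∧ Supp L a

def Cl (pos : Q.V → ℕ) (L : List Q.V) (S : Set (Q.V → ℤ)) : Prop :=
  (∀ s ∈ S, Phi L s) ∧ ∀ g, Phi L g → g ∉ S →
    ∃ f, Phi L f ∧ (∀ s ∈ S, eu pos s f ≤ 0) ∧ 0 < eu pos g f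

def StarP (pos : Q.V → ℕ) : Prop :=
  ∀ (S : Set (Q.V → ℤ)) (g f : Q.V → ℤ), (∀ s ∈ S, IsPosRoot Q s) → IsPosRoot Q g → IsPosRoot Q f →
    (∀ s ∈ S, eu pos s f ≤ 0) → 0 < eu pos g f →
    ∃ f', IsPosRoot Q f' ∧ (∀ v, f' v ≤ g v) ∧ (∀ s ∈ S, eu pos s f' ≤ 0) ∧ 0 < eu pos g f'

lemma nb_nonneg (x : Q.V) (a : Q.V → ℤ) (ha : ∀ v, 0 ≤ a v) : 0 ≤ nb Q x a := by
  unfold nb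
  refine Finset.sum_nonneg fun j _ => ?_
  simpa using mul_nonneg (adj_nonneg x j) (ha j)

lemma eu_simRoot_pos (hft : FiniteType Q) {pos : Q.V → ℕ} {x : Q.V} {L : List Q.V}
    (hm : MinOn pos x L) {f : Q.V → ℤ} (hf : Phi L f) (h : 0 < eu pos (simRoot Q x) f) :
    f = simRoot Q x := by
  rw [eu_min_left hm hf.2] at h
  have h1 := nb_nonneg x f hf.1.1
  symm
  apply posRoot_eq_of_two_le hft _ _ (posRoot_simRoot x) hf.1
  rw [sE_simRoot]; omega

lemma supp_rot {x : Q.V} {L : List Q.V} {a : Q.V → ℤ} : Supp (L ++ [x]) a ↔ Supp (x :: L) a := by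
  unfold Supp
  constructor <;> intro h v hv <;> apply h <;> simp at hv ⊢ <;> tauto

lemma cl_take (hft : FiniteType Q) {pos : Q.V → ℕ} (hpos : Function.Injective pos) {x : Q.V}
    {L : List Q.V} (hs : Sorted pos (x :: L)) {S : Set (Q.V → ℤ)} (h : Cl pos (x :: L) S)
    (hx : simRoot Q x ∈ S) :
    Cl (rotp pos x) (L ++ [x]) (sref Q x '' (S \ {simRoot Q x})) := by
  have hr := rotp_rot hs
  have hsx : Supp (x :: L) (simRoot Q x) := supp_simRoot hr.mem
  refine ⟨?_, ?_⟩
  · rintro _ ⟨s, ⟨h1, h2⟩, rfl⟩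
    exact ⟨sref_posRoot hft x s (h.1 s h1).1 h2, supp_rot.mpr (supp_sref hr.mem (h.1 s h1).2)⟩
  · intro g hg hgS
    by_cases hgx : g = simRoot Q x
    · refine ⟨simRoot Q x, ⟨posRoot_simRoot x, supp_rot.mpr hsx⟩, ?_, ?_⟩
      · rintro _ ⟨s, ⟨h1, h2⟩, rfl⟩
        have e : simRoot Q x = sref Q x (-simRoot Q x) := by
          rw [sref_neg, sref_simRoot, neg_neg]
        rw [e, eu_reflect hr (h.1 s h1).2 (fun v hv => by simp [hsx v hv]), eu_neg_right,
          eu_min_right hr.min (h.1 s h1).2]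
        have := (h.1 s h1).1.1 x
        omega
      · rw [hgx, eu_self _ (rotp_inj hpos x) _ (posRoot_simRoot x)]; norm_num
    · have hg' : Phi (x :: L) (sref Q x g) :=
        ⟨sref_posRoot hft x g hg.1 hgx, supp_sref hr.mem (supp_rot.mp hg.2)⟩
      have hn : sref Q x g ∉ S := fun hh =>
        hgS ⟨sref Q x g, ⟨hh, sref_ne_simRoot hg.1⟩, sref_invol x g⟩
      obtain ⟨f, hf, hf1, hf2⟩ := h.2 _ hg' hn
      have hfx : f ≠ simRoot Q x := by
        intro e
        have := hf1 _ hx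
        rw [e, eu_self _ hpos _ (posRoot_simRoot x)] at this
        omega
      refine ⟨sref Q x f, ⟨sref_posRoot hft x f hf.1 hfx, supp_rot.mpr (supp_sref hr.mem hf.2)⟩,
        ?_, ?_⟩
      · rintro _ ⟨s, ⟨h1, h2⟩, rfl⟩
        rw [eu_reflect hr (h.1 s h1).2 hf.2]; exact hf1 s h1
      · rw [← eu_reflect hr hg'.2 hf.2, sref_invol] at hf2
        exact hf2

lemma cl_untake (hft : FiniteType Q) {pos : Q.V → ℕ} {x : Q.V}
    {L : List Q.V} (hs : Sorted pos (x :: L)) {S : Set (Q.V → ℤ)}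
    (h : Cl (rotp pos x) (L ++ [x]) S) (hx : simRoot Q x ∉ S) :
    Cl pos (x :: L) (insert (simRoot Q x) (sref Q x '' S)) := by
  have hr := rotp_rot hs
  have hsx : Supp (x :: L) (simRoot Q x) := supp_simRoot hr.mem
  refine ⟨?_, ?_⟩
  · rintro _ (rfl | ⟨s, h1, rfl⟩)
    · exact ⟨posRoot_simRoot x, hsx⟩
    · exact ⟨sref_posRoot hft x s (h.1 s h1).1 (fun e => hx (e ▸ h1)),
        supp_sref hr.mem (supp_rot.mp (h.1 s h1).2)⟩
  · intro g hg hgS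
    have hgx : g ≠ simRoot Q x := fun e => hgS (Or.inl e)
    have hg' : Phi (L ++ [x]) (sref Q x g) :=
      ⟨sref_posRoot hft x g hg.1 hgx, supp_rot.mpr (supp_sref hr.mem hg.2)⟩
    have hn : sref Q x g ∉ S := fun hh => hgS (Or.inr ⟨_, hh, sref_invol x g⟩)
    obtain ⟨f, hf, hf1, hf2⟩ := h.2 _ hg' hn
    have hfx : f ≠ simRoot Q x := by
      intro e
      have e' : simRoot Q x = sref Q x (-simRoot Q x) := by
        rw [sref_neg, sref_simRoot, neg_neg]
      rw [e, e', eu_reflect hr hg.2 (fun v hv => by simp [hsx v hv]), eu_neg_right,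
        eu_min_right hr.min hg.2] at hf2
      have := hg.1.1 x
      omega
    have hf' : Phi (x :: L) (sref Q x f) :=
      ⟨sref_posRoot hft x f hf.1 hfx, supp_sref hr.mem (supp_rot.mp hf.2)⟩
    refine ⟨sref Q x f, hf', ?_, ?_⟩
    · rintro _ (rfl | ⟨s, h1, rfl⟩)
      · by_contra hc
        exact sref_ne_simRoot hf.1 (eu_simRoot_pos hft hr.min hf' (not_le.mp hc))
      · rw [← eu_reflect hr (supp_sref hr.mem (supp_rot.mp (h.1 s h1).2)) hf'.2, sref_invol,
          sref_invol]
        exact hf1 s h1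
    · rw [← eu_reflect hr hg.2 hf'.2, sref_invol]; exact hf2

lemma cl_skip (hft : FiniteType Q) {pos : Q.V → ℕ} (hstar : StarP pos) {x : Q.V}
    {L : List Q.V} (hs : Sorted pos (x :: L)) {S : Set (Q.V → ℤ)} (h : Cl pos (x :: L) S)
    (hx : simRoot Q x ∉ S) : Cl pos L S := by
  have hr := rotp_rot hs
  have hsx : Supp (x :: L) (simRoot Q x) := supp_simRoot hr.mem
  obtain ⟨f, hf, hf1, hf2⟩ := h.2 _ ⟨posRoot_simRoot x, hsx⟩ hx
  have hfx := eu_simRoot_pos hft hr.min hf hf2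
  subst hfx
  have h0 : ∀ s ∈ S, s x = 0 := by
    intro s hsS
    have := hf1 s hsS
    rw [eu_min_right hr.min (h.1 s hsS).2] at this
    have := (h.1 s hsS).1.1 x
    omega
  refine ⟨fun s hsS => ⟨(h.1 s hsS).1, fun v hv => ?_⟩, ?_⟩
  · by_cases e : v = x
    · rw [e]; exact h0 s hsS
    · exact (h.1 s hsS).2 v (by simp [e, hv])
  · intro g hg hgS
    obtain ⟨f, hf, hf1, hf2⟩ := h.2 g ⟨hg.1, fun v hv => hg.2 v (fun h => hv (by simp [h]))⟩ hgS
    obtain ⟨f', h1, h2, h3, h4⟩ := hstar S g f (fun s hs => (h.1 s hs).1) hg.1 hf.1 hf1 hf2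
    refine ⟨f', ⟨h1, fun v hv => ?_⟩, h3, h4⟩
    have := h2 v
    rw [hg.2 v hv] at this
    exact le_antisymm this (h1.1 v)

lemma cl_unskip {pos : Q.V → ℕ} {x : Q.V}
    {L : List Q.V} (hs : Sorted pos (x :: L)) {S : Set (Q.V → ℤ)} (h : Cl pos L S) :
    Cl pos (x :: L) S := by
  have hr := rotp_rot hs
  have hxL : x ∉ L := (List.nodup_cons.mp hs.nodup).1
  have up : ∀ a : Q.V → ℤ, Supp L a → Supp (x :: L) a := fun a ha v hv =>
    ha v (fun h => hv (by simp [h]))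
  refine ⟨fun s hsS => ⟨(h.1 s hsS).1, up s (h.1 s hsS).2⟩, ?_⟩
  intro g hg hgS
  by_cases hgx : g x = 0
  · obtain ⟨f, hf, hf1, hf2⟩ := h.2 g ⟨hg.1, fun v hv => by
      by_cases e : v = x
      · rw [e]; exact hgx
      · exact hg.2 v (by simp [e, hv])⟩ hgS
    exact ⟨f, ⟨hf.1, up f hf.2⟩, hf1, hf2⟩
  · refine ⟨simRoot Q x, ⟨posRoot_simRoot x, supp_simRoot hr.mem⟩, fun s hsS => ?_, ?_⟩
    · rw [eu_min_right hr.min (up s (h.1 s hsS).2), (h.1 s hsS).2 x hxL]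
    · rw [eu_min_right hr.min hg.2]
      have := hg.1.1 x
      omega

inductive SW : List Q.V → List Q.V → Prop
  | nil (L) : SW L []
  | skip (x L u) : SW L u → SW (x :: L) u
  | take (x L u) : SW (L ++ [x]) u → SW (x :: L) (x :: u)

lemma inv_cons (hft : FiniteType Q) {x : Q.V} {u : List Q.V} (hx : simRoot Q x ∉ inv u) :
    inv (x :: u) = insert (simRoot Q x) (sref Q x '' inv u) := by
  ext a
  constructor
  · intro ha
    by_cases e : a = simRoot Q x
    · exact Or.inl e
    · exact Or.inr ⟨_, (mem_inv_cons_ne hft x u a ha.1 e).mp ha, sref_invol x a⟩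
  · rintro (rfl | ⟨s, hs, rfl⟩)
    · exact (mem_inv_cons_self hft x u).mpr hx
    · have hne : s ≠ simRoot Q x := fun e => hx (e ▸ hs)
      rw [mem_inv_cons_ne hft x u _ (sref_posRoot hft x s hs.1 hne) (sref_ne_simRoot hs.1),
        sref_invol]
      exact hs

lemma phi_nil (a : Q.V → ℤ) : ¬ Phi [] a := fun h =>
  h.1.2.1 (funext fun v => h.2 v (by simp))

lemma cl_word (hft : FiniteType Q)
    (hstar : ∀ pos : Q.V → ℕ, Function.Injective pos → StarP pos) (n : ℕ) :
    ∀ (pos : Q.V → ℕ) (L : List Q.V) (S : Set (Q.V → ℤ)), Function.Injective pos → Sorted pos L →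
      Cl pos L S → L.length + S.ncard ≤ n →
      ∃ u, SW L u ∧ inv u = S ∧ u.length = S.ncard := by
  induction n with
  | zero =>
    intro pos L S hpos hs h hn
    have hL : L = [] := by rw [← List.length_eq_zero_iff]; omega
    subst hL
    have hS : S = ∅ := Set.eq_empty_of_forall_notMem fun a ha => phi_nil a (h.1 a ha)
    subst hS
    exact ⟨[], SW.nil _, inv_nil, by simp⟩
  | succ n ih =>
    intro pos L S hpos hs h hn
    cases L with
    | nil =>
      have hS : S = ∅ := Set.eq_empty_of_forall_notMem fun a ha => phi_nil a (h.1 a ha)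
      subst hS
      exact ⟨[], SW.nil _, inv_nil, by simp⟩
    | cons x L =>
      have hfin : S.Finite := (finite_roots hft).subset fun a ha => (h.1 a ha).1
      by_cases hx : simRoot Q x ∈ S
      · have hinj : Function.Injective (sref Q x) :=
          Function.LeftInverse.injective (sref_invol x)
        have hc : (sref Q x '' (S \ {simRoot Q x})).ncard + 1 = S.ncard := by
          rw [Set.ncard_image_of_injective _ hinj]
          exact Set.ncard_sdiff_singleton_add_one hx hfin
        obtain ⟨u, h1, h2, h3⟩ := ih _ _ _ (rotp_inj hpos x) (rotp_sorted hs)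
          (cl_take hft hpos hs h hx) (by simp at hn ⊢; omega)
        have hxu : simRoot Q x ∉ inv u := by
          rw [h2]
          rintro ⟨s, ⟨hs1, _⟩, e⟩
          exact sref_ne_simRoot (h.1 s hs1).1 e
        refine ⟨x :: u, SW.take x L u h1, ?_, by simp; omega⟩
        rw [inv_cons hft hxu, h2, Set.image_image]
        simp only [sref_invol, Set.image_id']
        simp [hx]
      · obtain ⟨u, h1, h2, h3⟩ := ih _ _ _ hpos (List.pairwise_cons.mp hs).2
          (cl_skip hft (hstar pos hpos) hs h hx) (by simp at hn ⊢; omega)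
        exact ⟨u, SW.skip x L u h1, h2, h3⟩

lemma word_cl (hft : FiniteType Q) {L u : List Q.V} (h : SW L u) (hred : Red u) :
    ∀ pos : Q.V → ℕ, Function.Injective pos → Sorted pos L → Cl pos L (inv u) := by
  induction h with
  | nil L =>
    intro pos hpos hs
    rw [inv_nil]
    exact ⟨fun s hs => hs.elim, fun g hg _ => ⟨g, hg, fun s hs => hs.elim, by
      rw [eu_self pos hpos g hg.1]; norm_num⟩⟩
  | skip x L u h ih =>
    intro pos hpos hs
    exact cl_unskip hs (ih hred pos hpos (List.pairwise_cons.mp hs).2)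
  | take x L u h ih =>
    intro pos hpos hs
    have hx := red_head hft hred
    rw [inv_cons hft hx]
    exact cl_untake hft hs (ih (red_tail hred) _ (rotp_inj hpos x) (rotp_sorted hs)) hx

end ClosedSets

/-! ### Sorting words and nested blocks -/

section Blocks

open scoped Classical

def blk (L0 : List Q.V) (A : Finset Q.V) : List Q.V := L0.filter fun v => decide (v ∈ A)

lemma sw_pass (A : Finset Q.V) (u : List Q.V) (R P : List Q.V) (h : SW (P ++ blk R A) u) :
    SW (R ++ P) (blk R A ++ u) := by
  induction R generalizing P with
  | nil => simpa [blk] using h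
  | cons x R ih =>
    by_cases hx : x ∈ A
    · have e : blk (x :: R) A = x :: blk R A := by simp [blk, hx]
      rw [e] at h ⊢
      refine SW.take x (R ++ P) (blk R A ++ u) ?_
      have := ih (P ++ [x]) (by simpa using h)
      simpa using this
    · have e : blk (x :: R) A = blk R A := by simp [blk, hx]
      rw [e] at h ⊢
      exact SW.skip x (R ++ P) _ (ih P h)

lemma sw_of_blocks (L0 : List Q.V) (As : List (Finset Q.V)) :
    ∀ C : Finset Q.V, (∀ A ∈ As, A ⊆ C) → As.Pairwise (fun A B => B ⊆ A) →
      SW (blk L0 C) (As.map (blk L0)).flatten := by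
  induction As with
  | nil => intro C _ _; exact SW.nil _
  | cons A As ih =>
    intro C hC hp
    rw [List.pairwise_cons] at hp
    have h1 := ih A hp.1 hp.2
    have hA : blk (blk L0 C) A = blk L0 A := by
      unfold blk
      rw [List.filter_filter]
      apply List.filter_congr
      intro v _
      have := hC A (by simp)
      by_cases hv : v ∈ A
      · simp [hv, this hv]
      · simp [hv]
    have := sw_pass A (As.map (blk L0)).flatten (blk L0 C) [] (by rw [hA]; simpa using h1)
    rw [hA] at this
    simpa using this

def St (L0 R P u : List Q.V) : Prop :=
  ∃ (B : Finset Q.V) (As : List (Finset Q.V)), (∀ v ∈ B, v ∈ R) ∧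
    (∀ A ∈ As, ∀ v ∈ A, v ∈ P ∨ v ∈ B) ∧ As.Pairwise (fun A B => B ⊆ A) ∧
    u = blk R B ++ (As.map (blk L0)).flatten

lemma blk_sub {L L0 : List Q.V} (h : L.Sublist L0) (hn : L0.Nodup) (B : Finset Q.V)
    (hB : ∀ v ∈ B, v ∈ L) : blk L0 B = blk L B := by
  induction h generalizing B with
  | slnil => rfl
  | cons x h ih =>
    rw [List.nodup_cons] at hn
    have : x ∉ B := fun hx => hn.1 (h.subset (hB x hx))
    have e := ih hn.2 B hB
    simpa [blk, this] using e
  | @cons_cons l1 l2 x h ih =>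
    rw [List.nodup_cons] at hn
    have e : blk l2 (B.erase x) = blk l1 (B.erase x) := ih hn.2 _ (by
      intro v hv
      rw [Finset.mem_erase] at hv
      have := hB v hv.2
      rw [List.mem_cons] at this
      tauto)
    have e1 : ∀ l : List Q.V, x ∉ l → blk l (B.erase x) = blk l B := by
      intro l hl
      apply List.filter_congr
      intro v hv
      have : v ≠ x := fun e => hl (e ▸ hv)
      simp [this]
    rw [e1 _ hn.1, e1 _ (fun h' => hn.1 (h.subset h'))] at e
    by_cases hx : x ∈ B
    · simpa [blk, hx] using e
    · simpa [blk, hx] using e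

lemma st_reduce {L0 L u : List Q.V} (hn : L0.Nodup) (hs : L.Sublist L0) (h : St L0 L [] u) :
    St L0 [] L u := by
  obtain ⟨B, As, h1, h2, h3, h4⟩ := h
  refine ⟨∅, B :: As, by simp, ?_, ?_, ?_⟩
  · intro A hA v hv
    rw [List.mem_cons] at hA
    rcases hA with rfl | hA
    · exact Or.inl (h1 v hv)
    · rcases h2 A hA v hv with h | h
      · simp at h
      · exact Or.inl (h1 v h)
  · rw [List.pairwise_cons]
    refine ⟨fun A hA v hv => ?_, h3⟩
    rcases h2 A hA v hv with h | h
    · simp at h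
    · exact h
  · rw [h4, List.map_cons, List.flatten_cons, blk_sub hs hn B h1]
    simp [blk]

lemma blocks_of_sw {L0 L u : List Q.V} (hn : L0.Nodup) (h : SW L u) :
    ∀ R P, L = R ++ P → (P ++ R).Sublist L0 → St L0 R P u := by
  induction h with
  | nil L =>
    intro R P _ _
    exact ⟨∅, [], by simp, by simp, by simp, by simp [blk]⟩
  | skip x L u h ih =>
    have key : ∀ R P, L = R ++ P → (P ++ x :: R).Sublist L0 → St L0 (x :: R) P u := by
      intro R P e hs
      obtain ⟨B, As, h1, h2, h3, h4⟩ := ih R P e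
        (((List.Sublist.refl P).append (List.sublist_cons_self x R)).trans hs)
      have hxR : x ∉ R := by
        have := (hs.nodup hn)
        rw [List.nodup_append, List.nodup_cons] at this
        exact this.2.1.1
      have hxB : x ∉ B := fun h => hxR (h1 x h)
      exact ⟨B, As, fun v hv => by simp [h1 v hv], h2, h3, by rw [h4]; simp [blk, hxB]⟩
    intro R P e hs
    cases R with
    | nil =>
      simp at e; subst e
      exact st_reduce hn (by simpa using hs) (key L [] (by simp) (by simpa using hs))
    | cons y R =>
      simp at e; obtain ⟨rfl, rfl⟩ := e
      exact key R P rfl hs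
  | take x L u h ih =>
    have key : ∀ R P, L = R ++ P → (P ++ x :: R).Sublist L0 → St L0 (x :: R) P (x :: u) := by
      intro R P e hs
      obtain ⟨B, As, h1, h2, h3, h4⟩ := ih R (P ++ [x]) (by simp [e]) (by simpa using hs)
      have hxR : x ∉ R := by
        have := (hs.nodup hn)
        rw [List.nodup_append, List.nodup_cons] at this
        exact this.2.1.1
      refine ⟨insert x B, As, ?_, ?_, h3, ?_⟩
      · intro v hv
        rw [Finset.mem_insert] at hv
        rcases hv with rfl | hv
        · simp
        · simp [h1 v hv]
      · intro A hA v hv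
        have := h2 A hA v hv
        simp at this ⊢; tauto
      · have e1 : blk (x :: R) (insert x B) = x :: blk R B := by
          unfold blk
          rw [List.filter_cons_of_pos (by simp)]
          congr 1
          apply List.filter_congr
          intro v hv
          have : v ≠ x := fun e => hxR (e ▸ hv)
          simp [this]
        rw [h4, e1]; simp
    intro R P e hs
    cases R with
    | nil =>
      simp at e; subst e
      exact st_reduce hn (by simpa using hs) (key L [] (by simp) (by simpa using hs))
    | cons y R =>
      simp at e; obtain ⟨rfl, rfl⟩ := e
      exact key R P rfl hs

lemma blk_length {L0 : List Q.V} (hn : L0.Nodup) (hall : ∀ v, v ∈ L0) (A : Finset Q.V) :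
    (blk L0 A).length = A.card := by
  have hn' : (blk L0 A).Nodup := hn.filter _
  rw [← List.toFinset_card_of_nodup hn']
  congr 1
  ext v
  simp [blk, hall]

lemma csort_iff (ord : Fin (Fintype.card Q.V) ≃ Q.V) (w : (Q.V → ℤ) → (Q.V → ℤ)) :
    CSortable Q ord w ↔ ∃ u, SW (List.ofFn fun i => ord i) u ∧ Red u ∧ w = wordProd Q u := by
  set L0 := List.ofFn fun i => ord i with hL0
  have hn : L0.Nodup := List.nodup_ofFn.mpr ord.injective
  have hall : ∀ v, v ∈ L0 := fun v => List.mem_ofFn.mpr (ord.surjective v)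
  have hblk : ∀ A, csortBlock Q ord A = blk L0 A := fun A => rfl
  have hlen : ∀ As : List (Finset Q.V),
      ((As.map (blk L0)).flatten).length = (As.map Finset.card).sum := by
    intro As
    rw [List.length_flatten, List.map_map]
    congr 1
    exact List.map_congr_left fun A _ => blk_length hn hall A
  have hconv : ∀ (m : ℕ) (A : Fin m → Finset Q.V),
      (List.ofFn fun i => csortBlock Q ord (A i)) = (List.ofFn A).map (blk L0) := by
    intro m A
    rw [List.map_ofFn]; rfl
  have hsum : ∀ (m : ℕ) (A : Fin m → Finset Q.V),
      ∑ i, (A i).card = ((List.ofFn A).map Finset.card).sum := by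
    intro m A
    rw [List.map_ofFn, List.sum_ofFn]; rfl
  constructor
  · rintro ⟨m, A, h1, h2, h3⟩
    rw [hconv] at h2
    refine ⟨_, ?_, ?_, h2⟩
    · have := sw_of_blocks L0 (List.ofFn A) Finset.univ (by simp)
        (List.pairwise_ofFn.mpr fun i j hij => h1 i j hij.le)
      have e : blk L0 Finset.univ = L0 := by simp [blk]
      rwa [e] at this
    · rw [← red_iff, ← h2, h3, hlen, hsum]
  · rintro ⟨u, h1, h2, rfl⟩
    obtain ⟨B, As, -, -, h5, h6⟩ := st_reduce hn (List.Sublist.refl _)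
      (blocks_of_sw hn h1 L0 [] (by simp) (by simp))
    have hu : u = (As.map (blk L0)).flatten := by simpa [blk] using h6
    refine ⟨As.length, fun i => As.get i, ?_, ?_, ?_⟩
    · intro i j hij
      rcases hij.lt_or_eq with h | rfl
      · exact List.pairwise_iff_get.mp h5 i j h
      · exact subset_rfl
    · rw [hconv, List.ofFn_get, ← hu]
    · rw [(red_iff u).mpr h2, hsum, List.ofFn_get, ← hlen, hu]

end Blocks

/-! ### Representations: components -/

section Comps

abbrev ob (M : RepC k Q) (v : Q.V) : ModuleCat.{0} k := M.obj ((Paths.of Q.V).obj v)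

def ar (M : RepC k Q) {x y : Q.V} (a : x ⟶ y) : ob M x →ₗ[k] ob M y :=
  (M.map ((Paths.of Q.V).map a)).hom

def co {M N : RepC k Q} (f : M ⟶ N) (v : Q.V) : ob M v →ₗ[k] ob N v :=
  (f.app ((Paths.of Q.V).obj v)).hom

variable {M N P : RepC k Q}

lemma co_comp (f : M ⟶ N) (g : N ⟶ P) (v : Q.V) : co (f ≫ g) v = co g v ∘ₗ co f v := rfl
lemma co_comp_apply (f : M ⟶ N) (g : N ⟶ P) (v : Q.V) (x : ob M v) :
    co (f ≫ g) v x = co g v (co f v x) := rfl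
lemma co_id (v : Q.V) : co (𝟙 M) v = LinearMap.id := rfl
lemma co_id_apply (v : Q.V) (x : ob M v) : co (𝟙 M) v x = x := rfl
lemma co_add (f g : M ⟶ N) (v : Q.V) : co (f + g) v = co f v + co g v := rfl
lemma co_zero (v : Q.V) : co (0 : M ⟶ N) v = 0 := rfl
lemma co_smul (t : k) (f : M ⟶ N) (v : Q.V) : co (t • f) v = t • co f v := rfl

lemma co_nat (f : M ⟶ N) {x y : Q.V} (a : x ⟶ y) (m : ob M x) :
    co f y (ar M a m) = ar N a (co f x m) := by
  have := f.naturality ((Paths.of Q.V).map a)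
  have := congrArg (fun g => g.hom m) this
  exact this

lemma rep_hom_ext {f g : M ⟶ N} (h : ∀ v, co f v = co g v) : f = g := by
  ext v x
  exact LinearMap.congr_fun (h v) x

lemma rep_hom_ext' {f g : M ⟶ N} (h : ∀ v x, co f v x = co g v x) : f = g :=
  rep_hom_ext fun v => LinearMap.ext (h v)

def mkHom (f : ∀ v, ob M v →ₗ[k] ob N v)
    (h : ∀ (x y : Q.V) (a : x ⟶ y) (m : ob M x), f y (ar M a m) = ar N a (f x m)) : M ⟶ N :=
  Paths.liftNatTrans (fun v => ModuleCat.ofHom (f v)) (fun {x y} a => by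
    apply ModuleCat.hom_ext
    apply LinearMap.ext
    intro m
    exact h x y a m)

lemma co_mkHom (f : ∀ v, ob M v →ₗ[k] ob N v)
    (h : ∀ (x y : Q.V) (a : x ⟶ y) (m : ob M x), f y (ar M a m) = ar N a (f x m)) (v : Q.V) :
    co (mkHom f h) v = f v := rfl

def mkRep (X : Q.V → ModuleCat.{0} k) (A : ∀ {x y : Q.V} (_ : x ⟶ y), X x →ₗ[k] X y) : RepC k Q :=
  Paths.lift { obj := X, map := fun a => ModuleCat.ofHom (A a) }

lemma ob_mkRep (X : Q.V → ModuleCat.{0} k) (A : ∀ {x y : Q.V} (_ : x ⟶ y), X x →ₗ[k] X y) (v : Q.V) :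
    ob (mkRep X A) v = X v := rfl

lemma ar_mkRep (X : Q.V → ModuleCat.{0} k) (A : ∀ {x y : Q.V} (_ : x ⟶ y), X x →ₗ[k] X y)
    {x y : Q.V} (a : x ⟶ y) (m : X x) :
    ar (mkRep X A) a m = A a m := by
  rfl

lemma mono_iff (f : M ⟶ N) : Mono f ↔ ∀ v, Function.Injective (co f v) := by
  rw [NatTrans.mono_iff_mono_app]
  constructor
  · intro h v; exact (ModuleCat.mono_iff_injective _).mp (h v)
  · intro h v; exact (ModuleCat.mono_iff_injective _).mpr (h v)

lemma epi_iff (f : M ⟶ N) : Epi f ↔ ∀ v, Function.Surjective (co f v) := by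
  rw [NatTrans.epi_iff_epi_app]
  constructor
  · intro h v; exact (ModuleCat.epi_iff_surjective _).mp (h v)
  · intro h v; exact (ModuleCat.epi_iff_surjective _).mpr (h v)

lemma isZero_iff : IsZero M ↔ ∀ v (x : ob M v), x = 0 := by
  rw [IsZero.iff_id_eq_zero]
  constructor
  · intro h v x
    rw [← co_id_apply v x, h]; rfl
  · intro h
    exact rep_hom_ext' fun v x => h v x

/-- short exact sequences, componentwise -/
structure SES (i : M ⟶ N) (p : N ⟶ P) : Prop where
  inj : ∀ v, Function.Injective (co i v)
  surj : ∀ v, Function.Surjective (co p v)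
  zero : ∀ v x, co p v (co i v x) = 0
  ex : ∀ v y, co p v y = 0 → ∃ x, co i v x = y

lemma SES.w {i : M ⟶ N} {p : N ⟶ P} (h : SES i p) : i ≫ p = 0 :=
  rep_hom_ext' fun v x => h.zero v x

lemma ses_of_shortExact (S : ShortComplex (RepC k Q)) (h : S.ShortExact) : SES S.f S.g where
  inj := (mono_iff _).mp h.mono_f
  surj := (epi_iff _).mp h.epi_g
  zero v x := by rw [← co_comp_apply, S.zero]; rfl
  ex v y hy := by
    have h1 := (h.map_of_exact ((evaluation (Paths Q.V) (ModuleCat.{0} k)).obj ((Paths.of Q.V).obj v))).exact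
    rw [ShortComplex.moduleCat_exact_iff] at h1
    exact h1 y hy

lemma ses_kernel (f : M ⟶ N) [Epi f] : SES (kernel.ι f) f :=
  ses_of_shortExact (ShortComplex.mk (kernel.ι f) f (kernel.condition f))
    { exact := ShortComplex.exact_kernel f
      mono_f := (inferInstance : Mono (kernel.ι f))
      epi_g := (inferInstance : Epi f) }

lemma ses_cokernel (f : M ⟶ N) [Mono f] : SES f (cokernel.π f) :=
  ses_of_shortExact (ShortComplex.mk f (cokernel.π f) (cokernel.condition f))
    { exact := ShortComplex.exact_cokernel f
      mono_f := (inferInstance : Mono f)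
      epi_g := (inferInstance : Epi (cokernel.π f)) }

lemma ses_biprod (A B : RepC k Q) : SES (biprod.inl : A ⟶ A ⊞ B) (biprod.snd : A ⊞ B ⟶ B) :=
  ses_of_shortExact _ (ShortComplex.Splitting.ofHasBinaryBiproduct A B).shortExact

lemma SES.desc {i : M ⟶ N} {p : N ⟶ P} (hs : SES i p) {X : RepC k Q} (h : N ⟶ X)
    (h0 : i ≫ h = 0) : ∃ h' : P ⟶ X, p ≫ h' = h := by
  choose s hsec using fun v => LinearMap.exists_rightInverse_of_surjective (co p v)
    (LinearMap.range_eq_top.mpr (hs.surj v))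
  have hsec' : ∀ v y, co p v (s v y) = y := fun v y => LinearMap.congr_fun (hsec v) y
  have key : ∀ v y, co h v (s v (co p v y)) = co h v y := by
    intro v y
    obtain ⟨x, hx⟩ := hs.ex v (s v (co p v y) - y) (by rw [map_sub, hsec', sub_self])
    have : co h v (co i v x) = 0 := by rw [← co_comp_apply, h0]; rfl
    rw [hx, map_sub, sub_eq_zero] at this
    exact this
  refine ⟨mkHom (fun v => co h v ∘ₗ s v) ?_, ?_⟩
  · intro x y a m
    obtain ⟨n, rfl⟩ := hs.surj x m
    simp only [LinearMap.comp_apply]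
    rw [← co_nat, key, key, co_nat]
  · refine rep_hom_ext' fun v x => ?_
    rw [co_comp_apply, co_mkHom]
    exact key v x

end Comps

/-! ### The standard resolution -/

section Ext

abbrev Arr (Q : FinQuiver) : Type := Σ x : Q.V, Σ y : Q.V, x ⟶ y

variable {M N P X Y : RepC k Q}

def DM (M N : RepC k Q) : (∀ v, ob M v →ₗ[k] ob N v) →ₗ[k]
    (∀ a : Arr Q, ob M a.1 →ₗ[k] ob N a.2.1) where
  toFun f a := ar N a.2.2 ∘ₗ f a.1 - f a.2.1 ∘ₗ ar M a.2.2
  map_add' f g := by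
    funext a; apply LinearMap.ext; intro m
    simp; abel
  map_smul' t f := by
    funext a; apply LinearMap.ext; intro m
    simp [smul_sub]

lemma DM_apply (f : ∀ v, ob M v →ₗ[k] ob N v) (a : Arr Q) (m : ob M a.1) :
    DM M N f a m = ar N a.2.2 (f a.1 m) - f a.2.1 (ar M a.2.2 m) := rfl

lemma DM_apply' (f : ∀ v, ob M v →ₗ[k] ob N v) (x y : Q.V) (a : x ⟶ y) (m : ob M x) :
    DM M N f (⟨x, ⟨y, a⟩⟩ : Arr Q) m = ar N a (f x m) - f y (ar M a m) := rfl

/-- vanishing of the first extension group -/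
def EZ (M N : RepC k Q) : Prop := Function.Surjective (DM M N)

def homEquiv (M N : RepC k Q) : (M ⟶ N) ≃ₗ[k] LinearMap.ker (DM M N) where
  toFun f := ⟨fun v => co f v, by
    rw [LinearMap.mem_ker]
    funext a; apply LinearMap.ext; intro m
    rw [DM_apply, co_nat, sub_self]; rfl⟩
  map_add' f g := rfl
  map_smul' t f := rfl
  invFun f := mkHom f.1 (fun x y a m => by
    have := LinearMap.congr_fun (congrFun (LinearMap.mem_ker.mp f.2) ⟨x, y, a⟩) m
    rw [DM_apply] at this
    exact (sub_eq_zero.mp this).symm)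
  left_inv f := rep_hom_ext fun v => rfl
  right_inv f := rfl

lemma finite_hom (hM : FinDim M) (hN : FinDim N) : FiniteDimensional k (M ⟶ N) := by
  have := hM; have := hN
  unfold FinDim at *
  exact Module.Finite.equiv (homEquiv M N).symm

def hdim (M N : RepC k Q) : ℤ := (Module.finrank k (M ⟶ N) : ℤ)

lemma hdim_eq (hM : FinDim M) (hN : FinDim N) :
    hdim M N + Module.finrank k (LinearMap.range (DM M N)) = euler Q (dimVec M) (dimVec N) +
      Module.finrank k (∀ a : Arr Q, ob M a.1 →ₗ[k] ob N a.2.1) := by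
  have := hM; have := hN
  unfold FinDim at *
  have h1 := LinearMap.finrank_range_add_finrank_ker (DM M N)
  rw [← (homEquiv M N).finrank_eq] at h1
  have h2 : Module.finrank k (∀ v, ob M v →ₗ[k] ob N v)
      = ∑ v, Module.finrank k (ob M v) * Module.finrank k (ob N v) := by
    rw [Module.finrank_pi_fintype]
    exact Finset.sum_congr rfl fun v _ => Module.finrank_linearMap k k _ _
  have h3 : Module.finrank k (∀ a : Arr Q, ob M a.1 →ₗ[k] ob N a.2.1)
      = ∑ a : Arr Q, Module.finrank k (ob M a.1) * Module.finrank k (ob N a.2.1) := by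
    rw [Module.finrank_pi_fintype]
    exact Finset.sum_congr rfl fun v _ => Module.finrank_linearMap k k _ _
  unfold hdim euler dimVec
  rw [h3]
  rw [h2] at h1
  have h4 := congrArg (Nat.cast : ℕ → ℤ) h1
  push_cast at h4 ⊢
  linarith

lemma euler_le_hdim (hM : FinDim M) (hN : FinDim N) :
    euler Q (dimVec M) (dimVec N) ≤ hdim M N := by
  have h := hdim_eq hM hN
  have := hM; have := hN
  unfold FinDim at *
  have h2 := Submodule.finrank_le (LinearMap.range (DM M N))
  omega

lemma EZ.hdim (hM : FinDim M) (hN : FinDim N) (h : EZ M N) :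
    hdim M N = euler Q (dimVec M) (dimVec N) := by
  have h1 := hdim_eq hM hN
  rw [LinearMap.range_eq_top.mpr h, finrank_top] at h1
  omega

lemma euler_lt_hdim (hM : FinDim M) (hN : FinDim N) (h : ¬ EZ M N) :
    euler Q (dimVec M) (dimVec N) < hdim M N := by
  have h1 := hdim_eq hM hN
  have := hM; have := hN
  unfold FinDim at *
  have h2 := Submodule.finrank_lt (s := LinearMap.range (DM M N))
    (fun e => h (LinearMap.range_eq_top.mp e))
  omega

lemma hdim_zero (h : HomZero M N) : hdim M N = 0 := by
  have : Subsingleton (M ⟶ N) := ⟨fun f g => by rw [h f, h g]⟩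
  unfold NCPaper.hdim
  rw [Module.finrank_zero_of_subsingleton]; rfl

lemma hdim_pos (hM : FinDim M) (hN : FinDim N) (h : ¬ HomZero M N) : 0 < hdim M N := by
  have := finite_hom hM hN
  unfold HomZero at h
  push Not at h
  obtain ⟨f, hf⟩ := h
  have : Nontrivial (M ⟶ N) := ⟨f, 0, hf⟩
  have := Module.finrank_pos (R := k) (M := (M ⟶ N))
  unfold NCPaper.hdim
  omega

lemma exists_retr {V W : Type} [AddCommGroup V] [Module k V] [AddCommGroup W] [Module k W]
    (f : V →ₗ[k] W) (hf : Function.Injective f) : ∃ g : W →ₗ[k] V, ∀ x, g (f x) = x := by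
  obtain ⟨g, hg⟩ := LinearMap.exists_leftInverse_of_injective f (LinearMap.ker_eq_bot.mpr hf)
  exact ⟨g, fun x => LinearMap.congr_fun hg x⟩

lemma exists_sect {V W : Type} [AddCommGroup V] [Module k V] [AddCommGroup W] [Module k W]
    (f : V →ₗ[k] W) (hf : Function.Surjective f) : ∃ g : W →ₗ[k] V, ∀ x, f (g x) = x := by
  obtain ⟨g, hg⟩ := LinearMap.exists_rightInverse_of_surjective f (LinearMap.range_eq_top.mpr hf)
  exact ⟨g, fun x => LinearMap.congr_fun hg x⟩

lemma EZ.solve (h : EZ M N) (g : ∀ a : Arr Q, ob M a.1 →ₗ[k] ob N a.2.1) :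
    ∃ f : ∀ v, ob M v →ₗ[k] ob N v, ∀ (x y : Q.V) (a : x ⟶ y) (m : ob M x),
      ar N a (f x m) - f y (ar M a m) = g ⟨x, y, a⟩ m := by
  obtain ⟨f, hf⟩ := h g
  exact ⟨f, fun x y a m => by rw [← hf]; rfl⟩

lemma EZ.mk (h : ∀ g : ∀ a : Arr Q, ob M a.1 →ₗ[k] ob N a.2.1,
    ∃ f : ∀ v, ob M v →ₗ[k] ob N v, ∀ (x y : Q.V) (a : x ⟶ y) (m : ob M x),
      ar N a (f x m) - f y (ar M a m) = g ⟨x, y, a⟩ m) : EZ M N := by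
  intro g
  obtain ⟨f, hf⟩ := h g
  refine ⟨f, ?_⟩
  funext a; apply LinearMap.ext; intro m
  exact hf a.1 a.2.1 a.2.2 m

lemma EZ.of_mono (h : EZ M N) (i : X ⟶ M) [hi : Mono i] : EZ X N := by
  rw [mono_iff] at hi
  choose r hr using fun v => exists_retr (co i v) (hi v)
  refine EZ.mk fun g => ?_
  obtain ⟨f, hf⟩ := h.solve fun a => g a ∘ₗ r a.1
  refine ⟨fun v => f v ∘ₗ co i v, fun x y a m => ?_⟩
  have := hf x y a (co i x m)
  simp only [LinearMap.comp_apply, hr] at this ⊢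
  rw [← this, co_nat]

lemma EZ.of_epi (h : EZ M N) (p : N ⟶ X) [hp : Epi p] : EZ M X := by
  rw [epi_iff] at hp
  choose s hs using fun v => exists_sect (co p v) (hp v)
  refine EZ.mk fun g => ?_
  obtain ⟨f, hf⟩ := h.solve fun a => s a.2.1 ∘ₗ g a
  refine ⟨fun v => co p v ∘ₗ f v, fun x y a m => ?_⟩
  have := congrArg (co p y) (hf x y a m)
  simp only [LinearMap.comp_apply, hs, map_sub] at this ⊢
  rw [← this, co_nat]

lemma EZ.ext_left {i : X ⟶ M} {p : M ⟶ Y} (hs : SES i p) (h1 : EZ X N) (h2 : EZ Y N) : EZ M N := by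
  choose r hr using fun v => exists_retr (co i v) (hs.inj v)
  choose s hsec using fun v => exists_sect (co p v) (hs.surj v)
  refine EZ.mk fun g => ?_
  obtain ⟨f1, hf1⟩ := h1.solve fun a => g a ∘ₗ co i a.1
  let g2 : ∀ a : Arr Q, ob M a.1 →ₗ[k] ob N a.2.1 :=
    fun a => g a - DM M N (fun v => f1 v ∘ₗ r v) a
  have hg2 : ∀ a m, g2 a (s a.1 (co p a.1 m)) = g2 a m := by
    intro a m
    obtain ⟨x, hx⟩ := hs.ex a.1 (s a.1 (co p a.1 m) - m) (by rw [map_sub, hsec, sub_self])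
    have h0 : g2 a (co i a.1 x) = 0 := by
      simp only [g2, LinearMap.sub_apply, DM_apply, LinearMap.comp_apply, hr, ← co_nat]
      rw [hf1]
      simp
    rw [hx, map_sub, sub_eq_zero] at h0
    exact h0
  obtain ⟨f2, hf2⟩ := h2.solve fun a => g2 a ∘ₗ s a.1
  refine ⟨fun v => f1 v ∘ₗ r v + f2 v ∘ₗ co p v, fun x y a m => ?_⟩
  have h3 := hf2 x y a (co p x m)
  simp only [LinearMap.comp_apply] at h3
  rw [hg2 ⟨x, y, a⟩ m] at h3
  simp only [g2, LinearMap.sub_apply] at h3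
  rw [DM_apply'] at h3
  simp only [LinearMap.comp_apply] at h3
  simp only [LinearMap.add_apply, LinearMap.comp_apply, map_add, co_nat]
  rw [eq_comm, sub_eq_iff_eq_add] at h3
  rw [h3]; abel

lemma EZ.ext_right {i : X ⟶ N} {p : N ⟶ Y} (hs : SES i p) (h1 : EZ M X) (h2 : EZ M Y) : EZ M N := by
  choose r hr using fun v => exists_retr (co i v) (hs.inj v)
  choose s hsec using fun v => exists_sect (co p v) (hs.surj v)
  refine EZ.mk fun g => ?_
  obtain ⟨f1, hf1⟩ := h2.solve fun a => co p a.2.1 ∘ₗ g a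
  let g2 : ∀ a : Arr Q, ob M a.1 →ₗ[k] ob N a.2.1 :=
    fun a => g a - DM M N (fun v => s v ∘ₗ f1 v) a
  have hg2 : ∀ a m, co i a.2.1 (r a.2.1 (g2 a m)) = g2 a m := by
    intro a m
    obtain ⟨x, hx⟩ := hs.ex a.2.1 (g2 a m) (by
      have := hf1 a.1 a.2.1 a.2.2 m
      simp only [LinearMap.comp_apply] at this
      simp only [g2, LinearMap.sub_apply, DM_apply, LinearMap.comp_apply, map_sub, hsec, co_nat]
      rw [this]; exact sub_self _)
    rw [← hx, hr]
  obtain ⟨f2, hf2⟩ := h1.solve fun a => r a.2.1 ∘ₗ g2 a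
  refine ⟨fun v => s v ∘ₗ f1 v + co i v ∘ₗ f2 v, fun x y a m => ?_⟩
  have h3 := congrArg (co i y) (hf2 x y a m)
  simp only [LinearMap.comp_apply] at h3
  rw [hg2 ⟨x, y, a⟩ m] at h3
  simp only [g2, LinearMap.sub_apply] at h3
  rw [DM_apply'] at h3
  simp only [LinearMap.comp_apply, map_sub, co_nat] at h3
  simp only [LinearMap.add_apply, LinearMap.comp_apply, map_add]
  rw [eq_comm, sub_eq_iff_eq_add] at h3
  rw [h3]; abel

/-- extending a map along a monomorphism with `EZ` cokernel -/
lemma EZ.extend {i : X ⟶ M} {p : M ⟶ Y} (hs : SES i p) (q : X ⟶ N) (h : EZ Y N) :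
    ∃ q' : M ⟶ N, i ≫ q' = q := by
  choose r hr using fun v => exists_retr (co i v) (hs.inj v)
  choose s hsec using fun v => exists_sect (co p v) (hs.surj v)
  let g2 : ∀ a : Arr Q, ob M a.1 →ₗ[k] ob N a.2.1 := fun a => DM M N (fun v => co q v ∘ₗ r v) a
  have hg2 : ∀ a m, g2 a (s a.1 (co p a.1 m)) = g2 a m := by
    intro a m
    obtain ⟨x, hx⟩ := hs.ex a.1 (s a.1 (co p a.1 m) - m) (by rw [map_sub, hsec, sub_self])
    have h0 : g2 a (co i a.1 x) = 0 := by
      simp only [g2, DM_apply, LinearMap.comp_apply, hr, ← co_nat]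
      simp
    rw [hx, map_sub, sub_eq_zero] at h0
    exact h0
  obtain ⟨f2, hf2⟩ := h.solve fun a => g2 a ∘ₗ s a.1
  refine ⟨mkHom (fun v => co q v ∘ₗ r v - f2 v ∘ₗ co p v) ?_, ?_⟩
  · intro x y a m
    have h3 := hf2 x y a (co p x m)
    simp only [LinearMap.comp_apply] at h3
    rw [hg2 ⟨x, y, a⟩ m] at h3
    simp only [g2] at h3
    rw [DM_apply'] at h3
    simp only [LinearMap.comp_apply] at h3
    simp only [LinearMap.sub_apply, LinearMap.comp_apply, map_sub, co_nat]
    rw [sub_eq_sub_iff_add_eq_add] at h3 ⊢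
    rw [add_comm, h3, add_comm]
  · refine rep_hom_ext' fun v x => ?_
    rw [co_comp_apply, co_mkHom]
    simp only [LinearMap.sub_apply, LinearMap.comp_apply, hr, hs.zero, map_zero, sub_zero]

/-- lifting a map along an epimorphism with `EZ` kernel -/
lemma EZ.lift {i : X ⟶ M} {p : M ⟶ Y} (hs : SES i p) (q : N ⟶ Y) (h : EZ N X) :
    ∃ q' : N ⟶ M, q' ≫ p = q := by
  choose r hr using fun v => exists_retr (co i v) (hs.inj v)
  choose s hsec using fun v => exists_sect (co p v) (hs.surj v)
  let g2 : ∀ a : Arr Q, ob N a.1 →ₗ[k] ob M a.2.1 := fun a => DM N M (fun v => s v ∘ₗ co q v) a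
  have hg2 : ∀ a m, co i a.2.1 (r a.2.1 (g2 a m)) = g2 a m := by
    intro a m
    obtain ⟨x, hx⟩ := hs.ex a.2.1 (g2 a m) (by
      simp only [g2, DM_apply, LinearMap.comp_apply, map_sub, hsec, co_nat]
      simp)
    rw [← hx, hr]
  obtain ⟨f2, hf2⟩ := h.solve fun a => r a.2.1 ∘ₗ g2 a
  refine ⟨mkHom (fun v => s v ∘ₗ co q v - co i v ∘ₗ f2 v) ?_, ?_⟩
  · intro x y a m
    have h3 := congrArg (co i y) (hf2 x y a m)
    simp only [LinearMap.comp_apply] at h3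
    rw [hg2 ⟨x, y, a⟩ m] at h3
    simp only [g2] at h3
    rw [DM_apply'] at h3
    simp only [LinearMap.comp_apply, map_sub, co_nat] at h3
    simp only [LinearMap.sub_apply, LinearMap.comp_apply, map_sub, co_nat]
    rw [sub_eq_sub_iff_add_eq_add] at h3 ⊢
    rw [add_comm, h3, add_comm]
  · refine rep_hom_ext' fun v x => ?_
    rw [co_comp_apply, co_mkHom]
    simp only [LinearMap.sub_apply, LinearMap.comp_apply, map_sub, hsec, hs.zero, sub_zero]

/-- nonsplit extensions -/
lemma exists_nonsplit (h : ¬ EZ Y X) : ∃ (M : RepC k Q) (i : X ⟶ M) (p : M ⟶ Y), SES i p ∧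
    ¬ ∃ r : M ⟶ X, i ≫ r = 𝟙 X := by
  unfold EZ Function.Surjective at h
  push Not at h
  obtain ⟨g, hg⟩ := h
  let M : RepC k Q := mkRep (fun v => ModuleCat.of k (ob X v × ob Y v))
    (fun {x y} a => LinearMap.prod
      ((ar X a) ∘ₗ LinearMap.fst k _ _ + g ⟨x, y, a⟩ ∘ₗ LinearMap.snd k _ _)
      ((ar Y a) ∘ₗ LinearMap.snd k _ _))
  let i : X ⟶ M := mkHom (fun v => LinearMap.inl k (ob X v) (ob Y v)) (by
    intro x y a m
    change ((ar X a m, 0) : ob X y × ob Y y) = (ar X a m + g ⟨x, y, a⟩ 0, ar Y a 0)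
    simp)
  let p : M ⟶ Y := mkHom (fun v => LinearMap.snd k (ob X v) (ob Y v)) (by
    intro x y a m
    rfl)
  refine ⟨M, i, p, ⟨?_, ?_, ?_, ?_⟩, ?_⟩
  · intro v x y hxy
    exact congrArg Prod.fst hxy
  · intro v y
    exact ⟨((0, y) : ob X v × ob Y v), rfl⟩
  · intro v x; rfl
  · intro v y hy
    exact ⟨y.1, Prod.ext rfl hy.symm⟩
  · rintro ⟨r, hr⟩
    have hr' : ∀ v (x : ob X v), co r v ((x, 0) : ob X v × ob Y v) = x := by
      intro v x
      have := LinearMap.congr_fun (congrArg (fun f => co f v) hr) x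
      exact this
    apply hg (fun v => co r v ∘ₗ LinearMap.inr k (ob X v) (ob Y v))
    funext a; apply LinearMap.ext; intro m
    obtain ⟨x, y, a⟩ := a
    rw [DM_apply]
    have h1 := co_nat r a ((0, m) : ob X x × ob Y x)
    have h2 : ar M a ((0, m) : ob X x × ob Y x)
        = ((g ⟨x, y, a⟩ m, 0) : ob X y × ob Y y) + ((0, ar Y a m) : ob X y × ob Y y) := by
      change ((ar X a 0 + g ⟨x, y, a⟩ m, ar Y a m) : ob X y × ob Y y) = _
      simp
    rw [h2] at h1
    have h3 := map_add (co r y) ((g ⟨x, y, a⟩ m, 0) : ob X y × ob Y y)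
      ((0, ar Y a m) : ob X y × ob Y y)
    have h4 := h3.symm.trans h1
    have h5 := (congrArg (· + co r y ((0, ar Y a m) : ob X y × ob Y y)) (hr' y (g ⟨x, y, a⟩ m))).symm.trans h4
    change ar X a (co r x ((0, m) : ob X x × ob Y x))
      - (co r y ((0, ar Y a m) : ob X y × ob Y y)) = g ⟨x, y, a⟩ m
    exact sub_eq_of_eq_add h5.symm

end Ext

/-! ### Dimensions and indecomposable summands -/

section Dims

variable {M N P X Y : RepC k Q}

def tdim (M : RepC k Q) : ℕ := ∑ v : Q.V, Module.finrank k (ob M v)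

lemma tdim_cast (M : RepC k Q) : (tdim M : ℤ) = ∑ v : Q.V, dimVec M v := by
  unfold tdim dimVec
  push_cast
  rfl

lemma SES.finDim {i : X ⟶ M} {p : M ⟶ Y} (hs : SES i p) (h1 : FinDim X) (h2 : FinDim Y) :
    FinDim M := by
  intro v
  have := h1 v; have := h2 v
  have hex : Function.Exact (co i v) (co p v) := by
    intro y
    constructor
    · exact hs.ex v y
    · rintro ⟨x, rfl⟩; exact hs.zero v x
  exact Module.Finite.of_exact hex (hs.surj v)

lemma FinDim.of_mono (h : FinDim M) (i : X ⟶ M) [hi : Mono i] : FinDim X := by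
  rw [mono_iff] at hi
  intro v
  have := h v
  exact Module.Finite.of_injective (co i v) (hi v)

lemma FinDim.of_epi (h : FinDim M) (p : M ⟶ X) [hp : Epi p] : FinDim X := by
  rw [epi_iff] at hp
  intro v
  have := h v
  exact Module.Finite.of_surjective (co p v) (hp v)

lemma dimVec_le_of_mono (h : FinDim M) (i : X ⟶ M) [hi : Mono i] (v : Q.V) :
    dimVec X v ≤ dimVec M v := by
  rw [mono_iff] at hi
  have := h v
  have h1 := LinearMap.finrank_le_finrank_of_injective (hi v)
  unfold dimVec
  exact_mod_cast h1

lemma dimVec_le_of_epi (h : FinDim M) (p : M ⟶ X) [hp : Epi p] (v : Q.V) :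
    dimVec X v ≤ dimVec M v := by
  rw [epi_iff] at hp
  have := h v
  have h1 := (co p v).finrank_range_add_finrank_ker
  rw [LinearMap.range_eq_top.mpr (hp v), finrank_top] at h1
  unfold dimVec
  change ((Module.finrank k (ob X v) : ℕ) : ℤ) ≤ ((Module.finrank k (ob M v) : ℕ) : ℤ)
  omega

lemma SES.dim {i : X ⟶ M} {p : M ⟶ Y} (hs : SES i p) (h : FinDim M) :
    dimVec M = dimVec X + dimVec Y := by
  funext v
  have := h v
  have h1 := (co p v).finrank_range_add_finrank_ker
  rw [LinearMap.range_eq_top.mpr (hs.surj v), finrank_top] at h1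
  have h2 : LinearMap.ker (co p v) = LinearMap.range (co i v) := by
    ext y
    rw [LinearMap.mem_ker, LinearMap.mem_range]
    constructor
    · exact hs.ex v y
    · rintro ⟨x, rfl⟩; exact hs.zero v x
  rw [h2, LinearMap.finrank_range_of_inj (hs.inj v)] at h1
  change ((Module.finrank k (ob M v) : ℕ) : ℤ) = ((Module.finrank k (ob X v) : ℕ) : ℤ)
    + ((Module.finrank k (ob Y v) : ℕ) : ℤ)
  omega

lemma SES.tdim {i : X ⟶ M} {p : M ⟶ Y} (hs : SES i p) (h : FinDim M) :
    tdim M = tdim X + tdim Y := by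
  have h1 : (NCPaper.tdim M : ℤ) = NCPaper.tdim X + NCPaper.tdim Y := by
    rw [tdim_cast, tdim_cast, tdim_cast, hs.dim h, ← Finset.sum_add_distrib]
    rfl
  exact_mod_cast h1

lemma tdim_zero_iff (h : FinDim M) : tdim M = 0 ↔ IsZero M := by
  rw [isZero_iff]
  unfold tdim
  rw [Finset.sum_eq_zero_iff]
  constructor
  · intro h1 v x
    have := h v
    have h2 : Subsingleton (ob M v) := Module.finrank_zero_iff.mp (h1 v (Finset.mem_univ v))
    exact Subsingleton.elim _ _
  · intro h1 v _
    have : Subsingleton (ob M v) := ⟨fun a b => by rw [h1 v a, h1 v b]⟩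
    exact Module.finrank_zero_of_subsingleton

lemma tdim_pos (h : FinDim M) (h0 : ¬ IsZero M) : 0 < tdim M :=
  Nat.pos_of_ne_zero fun e => h0 ((tdim_zero_iff h).mp e)

lemma tdim_le_of_mono (h : FinDim M) (i : X ⟶ M) [Mono i] : tdim X ≤ tdim M := by
  have := (ses_cokernel i).tdim h
  omega

lemma tdim_le_of_epi (h : FinDim M) (p : M ⟶ X) [Epi p] : tdim X ≤ tdim M := by
  have := (ses_kernel p).tdim h
  omega

lemma isIso_of_mono_tdim (h : FinDim M) (i : X ⟶ M) [Mono i] (e : tdim M ≤ tdim X) : IsIso i := by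
  have h1 := (ses_cokernel i).tdim h
  have h2 : IsZero (cokernel i) := (tdim_zero_iff (h.of_epi (cokernel.π i))).mp (by omega)
  have : Epi i := Preadditive.epi_of_isZero_cokernel i h2
  exact isIso_of_mono_of_epi i

lemma isIso_of_epi_tdim (h : FinDim M) (p : M ⟶ X) [Epi p] (e : tdim M ≤ tdim X) : IsIso p := by
  have h1 := (ses_kernel p).tdim h
  have h2 : IsZero (kernel p) := (tdim_zero_iff (h.of_mono (kernel.ι p))).mp (by omega)
  have : Mono p := Preadditive.mono_of_isZero_kernel p h2
  exact isIso_of_mono_of_epi p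

lemma finDim_biprod (h1 : FinDim X) (h2 : FinDim Y) : FinDim (X ⊞ Y) :=
  (ses_biprod X Y).finDim h1 h2

lemma indec_summand (h : Indec M) (i : X ⟶ M) (r : M ⟶ X) (e : i ≫ r = 𝟙 X) :
    IsZero X ∨ IsIso r := by
  have hr : Epi r := by
    have : Epi (i ≫ r) := by rw [e]; infer_instance
    exact epi_of_epi i r
  let S := ShortComplex.mk (kernel.ι r) r (kernel.condition r)
  have sp : S.Splitting := ShortComplex.Splitting.ofExactOfSection S
    (ShortComplex.exact_kernel r) i e (inferInstance : Mono (kernel.ι r))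
  rcases h.2 _ _ sp.isoBinaryBiproduct with h1 | h1
  · right
    have : Mono r := Preadditive.mono_of_isZero_kernel r h1
    exact isIso_of_mono_of_epi r
  · left; exact h1

/-- no proper nonzero summands -/
lemma indec_no_summand (h : Indec M) (hM : FinDim M) (i : X ⟶ M) (r : M ⟶ X) (e : i ≫ r = 𝟙 X)
    (hX : ¬ IsZero X) (hlt : tdim X < tdim M) : False := by
  rcases indec_summand h i r e with h1 | h1
  · exact hX h1
  · have : FinDim X := hM.of_epi r
    have := tdim_le_of_epi this (CategoryTheory.inv r)
    omega

lemma exists_indec_aux (X : RepC k Q) (P : ∀ A : RepC k Q, (A ⟶ X) → (X ⟶ A) → Prop)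
    (h0 : ∀ A i r, P A i r → ¬ IsZero A)
    (hs : ∀ A i r, P A i r → ∀ (B C : RepC k Q) (e : A ≅ B ⊞ C),
      P B (biprod.inl ≫ e.inv ≫ i) (r ≫ e.hom ≫ biprod.fst) ∨
      P C (biprod.inr ≫ e.inv ≫ i) (r ≫ e.hom ≫ biprod.snd)) (n : ℕ) :
    ∀ A i r, tdim A ≤ n → FinDim A → i ≫ r = 𝟙 A → P A i r →
      ∃ B i' r', FinDim B ∧ i' ≫ r' = 𝟙 B ∧ Indec B ∧ P B i' r' := by
  induction n with
  | zero =>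
    intro A i r hn hA e hP
    exact absurd ((tdim_zero_iff hA).mp (by omega)) (h0 A i r hP)
  | succ n ih =>
    intro A i r hn hA e hP
    by_cases hI : Indec A
    · exact ⟨A, i, r, hA, e, hI, hP⟩
    unfold Indec at hI
    push Not at hI
    obtain ⟨B, C, e1, hB, hC⟩ := hI (h0 A i r hP)
    have hBC : FinDim (B ⊞ C) := hA.of_epi e1.hom
    have hBf : FinDim B := hBC.of_mono biprod.inl
    have hCf : FinDim C := hBC.of_mono biprod.inr
    have h1 := tdim_le_of_mono hA e1.inv
    have h2 := (ses_biprod B C).tdim hBC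
    have h3 := tdim_pos hBf hB
    have h4 := tdim_pos hCf hC
    have e' : ∀ {Z : RepC k Q} (g : A ⟶ Z), i ≫ r ≫ g = g := by
      intro Z g; rw [← Category.assoc, e, Category.id_comp]
    rcases hs A i r hP B C e1 with h | h
    · exact ih B _ _ (by omega) hBf (by simp [e']) h
    · exact ih C _ _ (by omega) hCf (by simp [e']) h

lemma exists_indec (X : RepC k Q) (hX : FinDim X) (P : ∀ A : RepC k Q, (A ⟶ X) → (X ⟶ A) → Prop)
    (h0 : ∀ A i r, P A i r → ¬ IsZero A)
    (hs : ∀ A i r, P A i r → ∀ (B C : RepC k Q) (e : A ≅ B ⊞ C),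
      P B (biprod.inl ≫ e.inv ≫ i) (r ≫ e.hom ≫ biprod.fst) ∨
      P C (biprod.inr ≫ e.inv ≫ i) (r ≫ e.hom ≫ biprod.snd)) (h1 : P X (𝟙 X) (𝟙 X)) :
    ∃ B i' r', FinDim B ∧ i' ≫ r' = 𝟙 B ∧ Indec B ∧ P B i' r' :=
  exists_indec_aux X P h0 hs (tdim X) X _ _ le_rfl hX (Category.id_comp _) h1

lemma exists_indec_of_map (hX : FinDim X) {J : RepC k Q} (f : J ⟶ X) (hf : f ≠ 0) :
    ∃ (B : RepC k Q) (i : B ⟶ X) (r : X ⟶ B), FinDim B ∧ i ≫ r = 𝟙 B ∧ Indec B ∧ f ≫ r ≠ 0 := by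
  refine exists_indec X hX (fun A i r => f ≫ r ≠ 0) ?_ ?_ ?_
  · intro A i r h hz
    exact h (hz.eq_zero_of_tgt _)
  · intro A i r h B C e
    by_contra hc
    push Not at hc
    obtain ⟨h1, h2⟩ := hc
    apply h
    have h3 : f ≫ r ≫ e.hom = 0 := by
      apply biprod.hom_ext
      · simpa using h1
      · simpa using h2
    have : (f ≫ r ≫ e.hom) ≫ e.inv = 0 := by rw [h3, zero_comp]
    simpa using this
  · simpa using hf

lemma exists_indec_of_ne (hX : FinDim X) (h : ¬ IsZero X) :
    ∃ (B : RepC k Q) (i : B ⟶ X) (r : X ⟶ B), FinDim B ∧ i ≫ r = 𝟙 B ∧ Indec B := by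
  obtain ⟨B, i, r, h1, h2, h3, _⟩ := exists_indec_of_map hX (𝟙 X)
    (fun e => h ((IsZero.iff_id_eq_zero X).mpr e))
  exact ⟨B, i, r, h1, h2, h3⟩

lemma EZ.of_isZero_left (h : IsZero X) : EZ X Y := by
  rw [isZero_iff] at h
  intro g
  refine ⟨0, ?_⟩
  funext a; apply LinearMap.ext; intro m
  rw [h _ m, map_zero, map_zero]

lemma EZ.of_isZero_right (h : IsZero Y) : EZ X Y := by
  rw [isZero_iff] at h
  intro g
  refine ⟨0, ?_⟩
  funext a; apply LinearMap.ext; intro m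
  rw [h _ (g a m)]; exact h _ _

lemma exists_indec_of_ez_left (hX : FinDim X) (h : ¬ EZ X Y) :
    ∃ (B : RepC k Q) (i : B ⟶ X) (r : X ⟶ B), FinDim B ∧ i ≫ r = 𝟙 B ∧ Indec B ∧ ¬ EZ B Y := by
  refine exists_indec X hX (fun A i r => ¬ EZ A Y) ?_ ?_ h
  · intro A i r h hz
    exact h (EZ.of_isZero_left hz)
  · intro A i r h B C e
    by_contra hc
    push Not at hc
    exact h ((EZ.ext_left (ses_biprod B C) hc.1 hc.2).of_mono e.hom)

lemma exists_indec_of_ez_right (hX : FinDim X) (h : ¬ EZ Y X) :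
    ∃ (B : RepC k Q) (i : B ⟶ X) (r : X ⟶ B), FinDim B ∧ i ≫ r = 𝟙 B ∧ Indec B ∧ ¬ EZ Y B := by
  refine exists_indec X hX (fun A i r => ¬ EZ Y A) ?_ ?_ h
  · intro A i r h hz
    exact h (EZ.of_isZero_right hz)
  · intro A i r h B C e
    by_contra hc
    push Not at hc
    exact h ((EZ.ext_right (ses_biprod B C) hc.1 hc.2).of_epi e.inv)

lemma mono_of_sect {i : X ⟶ M} {r : M ⟶ X} (e : i ≫ r = 𝟙 X) : Mono i := by
  have : Mono (i ≫ r) := by rw [e]; infer_instance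
  exact mono_of_mono i r

lemma epi_of_sect {i : X ⟶ M} {r : M ⟶ X} (e : i ≫ r = 𝟙 X) : Epi r := by
  have : Epi (i ≫ r) := by rw [e]; infer_instance
  exact epi_of_epi i r

/-- indecomposable summand of an image -/
lemma exists_mid (hM : FinDim M) (f : M ⟶ N) (hf : f ≠ 0) :
    ∃ (J : RepC k Q) (e : M ⟶ J) (m : J ⟶ N), Epi e ∧ Mono m ∧ Indec J ∧ FinDim J := by
  have hI : FinDim (Abelian.image f) := hM.of_epi (Abelian.factorThruImage f)
  have h0 : ¬ IsZero (Abelian.image f) := by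
    intro h
    apply hf
    rw [← Abelian.image.fac f, h.eq_zero_of_tgt (Abelian.factorThruImage f), zero_comp]
  obtain ⟨J, i, r, h1, h2, h3⟩ := exists_indec_of_ne hI h0
  have := mono_of_sect h2
  have := epi_of_sect h2
  exact ⟨J, Abelian.factorThruImage f ≫ r, i ≫ Abelian.image.ι f, epi_comp _ _, mono_comp _ _, h3, h1⟩

end Dims

/-! ### Indecomposables and positive roots -/

section Ringel

variable {M N P X Y : RepC k Q}

lemma dimVec_ne_zero (h : FinDim M) (h0 : ¬ IsZero M) : dimVec M ≠ 0 := by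
  intro e
  have h1 := tdim_pos h h0
  have h2 := tdim_cast M
  rw [e] at h2
  simp at h2
  omega

lemma euler_self_pos (hft : FiniteType Q) (h : FinDim M) (h0 : ¬ IsZero M) :
    1 ≤ euler Q (dimVec M) (dimVec M) := by
  have h1 := sE_pos hft _ (dimVec_ne_zero h h0)
  unfold symEuler at h1
  omega

lemma exists_factor (hM : FinDim M) (f : M ⟶ N) (hf : f ≠ 0) :
    ∃ (J : RepC k Q) (e : M ⟶ J) (m : J ⟶ N), Epi e ∧ Mono m ∧ ¬ IsZero J ∧ FinDim J ∧ e ≫ m = f := by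
  have hI : FinDim (Abelian.image f) := hM.of_epi (Abelian.factorThruImage f)
  have h0 : ¬ IsZero (Abelian.image f) := by
    intro h
    apply hf
    rw [← Abelian.image.fac f, h.eq_zero_of_tgt (Abelian.factorThruImage f), zero_comp]
  exact ⟨_, Abelian.factorThruImage f, Abelian.image.ι f, inferInstance, inferInstance, h0, hI,
    Abelian.image.fac f⟩

lemma brick_rigid [IsAlgClosed k] (hft : FiniteType Q) (hM : FinDim M) (h0 : ¬ IsZero M)
    (h : ∀ f : M ⟶ M, f ≠ 0 → IsIso f) : hdim M M = 1 ∧ EZ M M := by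
  have := finite_hom hM hM
  have h1 : Module.finrank k (M ⟶ M) = 1 := by
    apply finrank_endomorphism_eq_one k
    intro f
    refine ⟨?_, h f⟩
    intro hi e
    subst e
    apply h0
    rw [IsZero.iff_id_eq_zero]
    rw [← IsIso.hom_inv_id (0 : M ⟶ M), zero_comp]
  have h2 : hdim M M = 1 := by unfold hdim; rw [h1]; rfl
  refine ⟨h2, ?_⟩
  by_contra hE
  have h3 := euler_lt_hdim hM hM hE
  have h4 := euler_self_pos hft hM h0
  omega

/-- Ringel's lemma -/
lemma indec_brick [IsAlgClosed k] (hft : FiniteType Q) (n : ℕ) : ∀ M : RepC k Q, tdim M ≤ n →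
    FinDim M → Indec M → hdim M M = 1 ∧ EZ M M := by
  induction n with
  | zero =>
    intro M hn hM hI
    exact absurd ((tdim_zero_iff hM).mp (by omega)) hI.1
  | succ n ih =>
    intro M hn hM hI
    by_contra hcon
    have hex : ∃ f : M ⟶ M, f ≠ 0 ∧ ¬ IsIso f := by
      by_contra hc
      push Not at hc
      exact hcon (brick_rigid hft hM hI.1 hc)
    have hex2 : ∃ d : ℕ, ∃ (J : RepC k Q) (e : M ⟶ J) (m : J ⟶ M), Epi e ∧ Mono m ∧ ¬ IsZero J ∧
        FinDim J ∧ tdim J < tdim M ∧ tdim J = d := by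
      obtain ⟨f, hf, hni⟩ := hex
      obtain ⟨J, e, m, he, hm, hJ, hJf, hfac⟩ := exists_factor hM f hf
      refine ⟨tdim J, J, e, m, he, hm, hJ, hJf, ?_, rfl⟩
      by_contra hlt
      have h1 := isIso_of_epi_tdim hM e (by omega)
      have h2 := isIso_of_mono_tdim hM m (by omega)
      apply hni
      rw [← hfac]
      infer_instance
    classical
    let d := Nat.find hex2
    have hmin : ∀ (J : RepC k Q) (e : M ⟶ J) (m : J ⟶ M), Epi e → Mono m → ¬ IsZero J →
        FinDim J → tdim J < tdim M → d ≤ tdim J := by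
      intro J e m h1 h2 h3 h4 h5
      exact Nat.find_min' hex2 ⟨J, e, m, h1, h2, h3, h4, h5, rfl⟩
    obtain ⟨J, e, m, he, hm, hJ, hJf, hlt, hd⟩ := Nat.find_spec hex2
    change tdim J = d at hd
    have hg : m ≫ e = 0 := by
      by_contra hg
      obtain ⟨I, a, b, ha, hb, hI0, hIf, hfac⟩ := exists_factor hJf (m ≫ e) hg
      have hle : tdim I ≤ tdim J := tdim_le_of_epi hJf a
      have := hmin I (e ≫ a) (b ≫ m) (epi_comp _ _) (mono_comp _ _) hI0 hIf (by omega)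
      have h1 := isIso_of_epi_tdim hJf a (by omega)
      have h2 := isIso_of_mono_tdim hJf b (by omega)
      have h3 : IsIso (m ≫ e) := by rw [← hfac]; infer_instance
      exact indec_no_summand hI hM m (e ≫ CategoryTheory.inv (m ≫ e))
        (by rw [← Category.assoc, IsIso.hom_inv_id]) hJ hlt
    let j : J ⟶ kernel e := kernel.lift e m hg
    have hj : j ≫ kernel.ι e = m := kernel.lift_ι e m hg
    have hjm : Mono j := by
      have : Mono (j ≫ kernel.ι e) := by rw [hj]; exact hm
      exact mono_of_mono j (kernel.ι e)
    have hj0 : j ≠ 0 := by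
      intro h
      apply hJ
      rw [IsZero.iff_id_eq_zero, ← cancel_mono j, h]
      simp
    have hKf : FinDim (kernel e) := hM.of_mono (kernel.ι e)
    have hKd := (ses_kernel e).tdim hM
    have hJp := tdim_pos hJf hJ
    obtain ⟨B, i, r, hBf, hir, hBI, hjr⟩ := exists_indec_of_map hKf j hj0
    have him := mono_of_sect hir
    have hBK : tdim B ≤ tdim (kernel e) := tdim_le_of_mono hKf i
    have hmono : Mono (j ≫ r) := by
      obtain ⟨I, a, b, ha, hb, hI0, hIf, hfac⟩ := exists_factor hJf (j ≫ r) hjr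
      have hle : tdim I ≤ tdim J := tdim_le_of_epi hJf a
      have := hmin I (e ≫ a) (b ≫ i ≫ kernel.ι e) (epi_comp _ _)
        (by have := mono_comp i (kernel.ι e); exact mono_comp b (i ≫ kernel.ι e)) hI0 hIf (by omega)
      have h1 := isIso_of_epi_tdim hJf a (by omega)
      rw [← hfac]
      exact mono_comp _ _
    have hEZ : EZ J B := ((ih B (by omega) hBf hBI).2).of_mono (j ≫ r)
    obtain ⟨q, hq⟩ := hEZ.extend (ses_kernel e) r
    exact indec_no_summand hI hM (i ≫ kernel.ι e) q (by rw [Category.assoc, hq, hir]) hBI.1 (by omega)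

lemma indec_ez [IsAlgClosed k] (hft : FiniteType Q) (hM : FinDim M) (h : Indec M) : EZ M M :=
  (indec_brick hft (tdim M) M le_rfl hM h).2

lemma indec_hdim [IsAlgClosed k] (hft : FiniteType Q) (hM : FinDim M) (h : Indec M) : hdim M M = 1 :=
  (indec_brick hft (tdim M) M le_rfl hM h).1

lemma indec_posRoot [IsAlgClosed k] (hft : FiniteType Q) (hM : FinDim M) (h : Indec M) :
    IsPosRoot Q (dimVec M) := by
  refine ⟨fun v => ?_, dimVec_ne_zero hM h.1, ?_⟩
  · unfold dimVec; positivity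
  · have h1 := (indec_ez hft hM h).hdim hM hM
    rw [indec_hdim hft hM h] at h1
    unfold symEuler
    omega

lemma SES.liftz {i : X ⟶ M} {p : M ⟶ Y} (hs : SES i p) (h : N ⟶ M)
    (h0 : h ≫ p = 0) : ∃ h' : N ⟶ X, h' ≫ i = h := by
  choose r hr using fun v => exists_retr (co i v) (hs.inj v)
  have key : ∀ v y, co i v (r v (co h v y)) = co h v y := by
    intro v y
    obtain ⟨x, hx⟩ := hs.ex v (co h v y) (by rw [← co_comp_apply, h0]; rfl)
    rw [← hx, hr]
  refine ⟨mkHom (fun v => r v ∘ₗ co h v) ?_, ?_⟩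
  · intro x y a m
    apply hs.inj y
    rw [co_nat i]
    simp only [LinearMap.comp_apply]
    rw [key, key, co_nat]
  · refine rep_hom_ext' fun v x => ?_
    rw [co_comp_apply, co_mkHom]
    exact key v x

lemma hdim_le_left {i : X ⟶ M} {p : M ⟶ Y} (hs : SES i p) (hM : FinDim M) (hX : FinDim X)
    (hY : FinDim Y) (hN : FinDim N) : hdim M N ≤ hdim X N + hdim Y N ∧
      ((¬ ∀ q : X ⟶ N, ∃ q' : M ⟶ N, i ≫ q' = q) → hdim M N < hdim X N + hdim Y N) := by
  have := finite_hom hM hN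
  have := finite_hom hX hN
  have := finite_hom hY hN
  let Φ : (M ⟶ N) →ₗ[k] (X ⟶ N) := Linear.leftComp k N i
  let Ψ : (Y ⟶ N) →ₗ[k] (M ⟶ N) := Linear.leftComp k N p
  have h1 := Φ.finrank_range_add_finrank_ker
  have h2 : LinearMap.ker Φ ≤ LinearMap.range Ψ := by
    intro f hf
    obtain ⟨f', hf'⟩ := hs.desc f hf
    exact ⟨f', hf'⟩
  have h3 := Submodule.finrank_mono h2
  have h4 := Ψ.finrank_range_le
  have h5 := Submodule.finrank_le (LinearMap.range Φ)
  unfold hdim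
  refine ⟨by omega, fun hn => ?_⟩
  have h6 := Submodule.finrank_lt (s := LinearMap.range Φ) (by
    intro htop
    apply hn
    intro q
    exact LinearMap.range_eq_top.mp htop q)
  omega

lemma hdim_le_right {i : X ⟶ M} {p : M ⟶ Y} (hs : SES i p) (hM : FinDim M) (hX : FinDim X)
    (hY : FinDim Y) (hN : FinDim N) : hdim N M ≤ hdim N X + hdim N Y := by
  have := finite_hom hN hM
  have := finite_hom hN hX
  have := finite_hom hN hY
  let Φ : (N ⟶ M) →ₗ[k] (N ⟶ Y) := Linear.rightComp k N p
  let Ψ : (N ⟶ X) →ₗ[k] (N ⟶ M) := Linear.rightComp k N i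
  have h1 := Φ.finrank_range_add_finrank_ker
  have h2 : LinearMap.ker Φ ≤ LinearMap.range Ψ := by
    intro f hf
    obtain ⟨f', hf'⟩ := hs.liftz f hf
    exact ⟨f', hf'⟩
  have h3 := Submodule.finrank_mono h2
  have h4 := Ψ.finrank_range_le
  have h5 := Submodule.finrank_le (LinearMap.range Φ)
  unfold hdim
  omega

lemma exists_compl {i : X ⟶ M} {r : M ⟶ X} (e : i ≫ r = 𝟙 X) :
    ∃ ρ : M ⟶ kernel r, kernel.ι r ≫ ρ = 𝟙 _ ∧ i ≫ ρ = 0 := by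
  let S := ShortComplex.mk (kernel.ι r) r (kernel.condition r)
  let sp : S.Splitting := ShortComplex.Splitting.ofExactOfSection S
    (ShortComplex.exact_kernel r) i e (inferInstance : Mono (kernel.ι r))
  exact ⟨sp.r, sp.f_r, sp.s_r⟩

lemma hdim_ge_left {i : X ⟶ M} {r : M ⟶ X} (e : i ≫ r = 𝟙 X) (hM : FinDim M) (hN : FinDim N) :
    hdim X N + hdim (kernel r) N ≤ hdim M N := by
  obtain ⟨ρ, h1, h2⟩ := exists_compl e
  have := epi_of_sect e
  have := finite_hom hM hN
  have := finite_hom (hM.of_epi r) hN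
  have := finite_hom (hM.of_mono (kernel.ι r)) hN
  let Φ : ((X ⟶ N) × (kernel r ⟶ N)) →ₗ[k] (M ⟶ N) :=
    (Linear.leftComp k N r).coprod (Linear.leftComp k N ρ)
  have hΦ : Function.Injective Φ := by
    rw [injective_iff_map_eq_zero]
    rintro ⟨f, g⟩ hfg
    have hfg' : r ≫ f + ρ ≫ g = 0 := hfg
    have e1 : i ≫ (r ≫ f + ρ ≫ g) = f := by
      rw [Preadditive.comp_add, ← Category.assoc, ← Category.assoc, e, h2]; simp
    have e2 : kernel.ι r ≫ (r ≫ f + ρ ≫ g) = g := by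
      rw [Preadditive.comp_add, ← Category.assoc, ← Category.assoc, h1, kernel.condition]; simp
    rw [hfg', comp_zero] at e1 e2
    rw [← e1, ← e2]; rfl
  have h3 := LinearMap.finrank_le_finrank_of_injective hΦ
  rw [Module.finrank_prod] at h3
  unfold hdim
  omega

lemma hdim_ge_right {i : X ⟶ M} {r : M ⟶ X} (e : i ≫ r = 𝟙 X) (hM : FinDim M) (hN : FinDim N) :
    hdim N X + hdim N (kernel r) ≤ hdim N M := by
  obtain ⟨ρ, h1, h2⟩ := exists_compl e
  have := epi_of_sect e
  have := finite_hom hN hM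
  have := finite_hom hN (hM.of_epi r)
  have := finite_hom hN (hM.of_mono (kernel.ι r))
  let Φ : ((N ⟶ X) × (N ⟶ kernel r)) →ₗ[k] (N ⟶ M) :=
    (Linear.rightComp k N i).coprod (Linear.rightComp k N (kernel.ι r))
  have hΦ : Function.Injective Φ := by
    rw [injective_iff_map_eq_zero]
    rintro ⟨f, g⟩ hfg
    have hfg' : f ≫ i + g ≫ kernel.ι r = 0 := hfg
    have e1 : (f ≫ i + g ≫ kernel.ι r) ≫ r = f := by
      rw [Preadditive.add_comp, Category.assoc, Category.assoc, e, kernel.condition]; simp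
    have e2 : (f ≫ i + g ≫ kernel.ι r) ≫ ρ = g := by
      rw [Preadditive.add_comp, Category.assoc, Category.assoc, h1, h2]; simp
    rw [hfg', zero_comp] at e1 e2
    rw [← e1, ← e2]; rfl
  have h3 := LinearMap.finrank_le_finrank_of_injective hΦ
  rw [Module.finrank_prod] at h3
  unfold hdim
  omega

lemma hdim_self_pos (hM : FinDim M) (h : ¬ IsZero M) : 0 < hdim M M :=
  hdim_pos hM hM fun h0 => h ((IsZero.iff_id_eq_zero M).mpr (h0 _))

lemma exists_dim (k : Type) [Field k] (a : Q.V → ℤ) (ha : ∀ v, 0 ≤ a v) :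
    ∃ M : RepC k Q, FinDim M ∧ dimVec M = a := by
  refine ⟨mkRep (fun v => ModuleCat.of k (Fin (a v).toNat → k)) (fun _ => 0), ?_, ?_⟩
  · intro v
    change FiniteDimensional k (Fin (a v).toNat → k)
    infer_instance
  · funext v
    change ((Module.finrank k (Fin (a v).toNat → k) : ℕ) : ℤ) = a v
    rw [Module.finrank_fin_fun]
    exact Int.toNat_of_nonneg (ha v)

/-- every positive root is the dimension vector of an indecomposable -/
lemma exists_indec_posRoot [IsAlgClosed k] (hft : FiniteType Q) (a : Q.V → ℤ) (ha : IsPosRoot Q a) :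
    ∃ M : RepC k Q, FinDim M ∧ Indec M ∧ dimVec M = a := by
  classical
  have hex : ∃ n : ℕ, ∃ M : RepC k Q, FinDim M ∧ dimVec M = a ∧ Module.finrank k (M ⟶ M) = n := by
    obtain ⟨M, h1, h2⟩ := exists_dim k a ha.1
    exact ⟨_, M, h1, h2, rfl⟩
  obtain ⟨E, hE, hEd, hEn⟩ := Nat.find_spec hex
  have hmin : ∀ M : RepC k Q, FinDim M → dimVec M = a → hdim E E ≤ hdim M M := by
    intro M h1 h2
    have := Nat.find_min' hex ⟨M, h1, h2, rfl⟩
    unfold hdim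
    omega
  have hEZ : EZ E E := by
    by_contra hn
    obtain ⟨A, i, r, hA, hir, hAI, hAE⟩ := exists_indec_of_ez_left hE hn
    have := epi_of_sect hir
    have hC : FinDim (kernel r) := hE.of_mono (kernel.ι r)
    have hAC : ¬ EZ A (kernel r) := fun h =>
      hAE (EZ.ext_right (ses_kernel r) h (indec_ez hft hA hAI))
    obtain ⟨M, i', p', hs, hns⟩ := exists_nonsplit hAC
    have hM : FinDim M := hs.finDim hC hA
    have hMd : dimVec M = a := by
      rw [hs.dim hM, ← (ses_kernel r).dim hE, hEd]
    have h1 := hmin M hM hMd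
    have h2 := hdim_le_right hs hM hC hA hM
    have h3 := (hdim_le_left hs hM hC hA hC).2 (fun hall => hns (hall (𝟙 _)))
    have h4 := (hdim_le_left hs hM hC hA hA).1
    have h5 := hdim_ge_left hir hE hE
    have h6 := hdim_ge_right hir hE hA
    have h7 := hdim_ge_right hir hE hC
    omega
  have hE1 : hdim E E = 1 := by
    have h1 := hEZ.hdim hE hE
    have h2 := ha.2.2
    unfold symEuler at h2
    rw [hEd] at h1
    omega
  refine ⟨E, hE, ⟨?_, ?_⟩, hEd⟩
  · intro hz
    have := (tdim_zero_iff hE).mpr hz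
    apply ha.2.1
    rw [← hEd]
    funext v
    unfold tdim at this
    rw [Finset.sum_eq_zero_iff] at this
    have := this v (Finset.mem_univ v)
    change ((Module.finrank k (ob E v) : ℕ) : ℤ) = 0
    rw [this]; rfl
  · intro A B e
    by_contra hc
    push Not at hc
    obtain ⟨hA, hB⟩ := hc
    let i : A ⟶ E := biprod.inl ≫ e.inv
    let r : E ⟶ A := e.hom ≫ biprod.fst
    have hir : i ≫ r = 𝟙 A := by simp [i, r]
    have hAf : FinDim A := by
      have := epi_of_sect hir
      exact hE.of_epi r
    have h1 := hdim_ge_left hir hE hE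
    have h2 : 0 < hdim A E := hdim_pos hAf hE fun h => by
      apply hA
      have h3 := h i
      rw [IsZero.iff_id_eq_zero, ← hir, h3, zero_comp]
    have h3 : 0 < hdim (kernel r) E := hdim_pos (hE.of_mono (kernel.ι r)) hE fun h => by
      apply hB
      have h3 := h (kernel.ι r)
      have h4 : (biprod.inr ≫ e.inv : B ⟶ E) ≫ r = 0 := by simp [r]
      have h5 := kernel.lift_ι r _ h4
      rw [h3, comp_zero] at h5
      have h6 : (biprod.inr ≫ e.inv : B ⟶ E) ≫ e.hom ≫ biprod.snd = 𝟙 B := by simp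
      rw [← h5, zero_comp] at h6
      rw [IsZero.iff_id_eq_zero, ← h6]
    omega

end Ringel

/-! ### Hom-Ext exclusivity and torsion classes -/

section Excl

variable {M N P X Y : RepC k Q}

def Acy (Q : FinQuiver) : Prop := ∀ a b c : Q.V → ℤ, IsPosRoot Q a → IsPosRoot Q b → IsPosRoot Q c →
  euler Q a b < 0 → euler Q b c < 0 → euler Q c a < 0 → False

lemma excl_aux [IsAlgClosed k] (hft : FiniteType Q) (hacy : Acy Q) (n : ℕ) : ∀ M N : RepC k Q,
    tdim M + tdim N ≤ n → FinDim M → FinDim N → Indec M → Indec N → ¬ HomZero M N → EZ M N := by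
  induction n with
  | zero =>
    intro M N hn hM hN hMI hNI _
    exact absurd ((tdim_zero_iff hM).mp (by omega)) hMI.1
  | succ n ih =>
    intro M N hn hM hN hMI hNI hhom
    by_contra hE
    unfold HomZero at hhom
    push Not at hhom
    obtain ⟨f, hf⟩ := hhom
    obtain ⟨J, e, m, he, hm, hJI, hJ⟩ := exists_mid hM f hf
    have hJp := tdim_pos hJ hJI.1
    have hKf : FinDim (kernel e) := hM.of_mono (kernel.ι e)
    have hCf : FinDim (cokernel m) := hN.of_epi (cokernel.π m)
    have hK := (ses_kernel e).tdim hM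
    have hC := (ses_cokernel m).tdim hN
    have hKJ : EZ (kernel e) J := ((indec_ez hft hM hMI).of_epi e).of_mono (kernel.ι e)
    have hJN : EZ J N := (indec_ez hft hN hNI).of_mono m
    have hKN : ¬ EZ (kernel e) N := fun h => hE (EZ.ext_left (ses_kernel e) h hJN)
    have hKC : ¬ EZ (kernel e) (cokernel m) := fun h => hKN (EZ.ext_right (ses_cokernel m) hKJ h)
    obtain ⟨A, i, r, hA, hir, hAI, hAC⟩ := exists_indec_of_ez_left hKf hKC
    obtain ⟨B, i', r', hB, hir', hBI, hAB⟩ := exists_indec_of_ez_right hCf hAC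
    have h1 := mono_of_sect hir
    have h2 := mono_of_sect hir'
    have hAK := tdim_le_of_mono hKf i
    have hBC := tdim_le_of_mono hCf i'
    have hMp := tdim_pos hM hMI.1
    have hNp := tdim_pos hN hNI.1
    have hJA : ¬ EZ J A := by
      intro h
      obtain ⟨q, hq⟩ := h.extend (ses_kernel e) r
      exact indec_no_summand hMI hM (i ≫ kernel.ι e) q (by rw [Category.assoc, hq, hir]) hAI.1
        (by omega)
    have hBJ : ¬ EZ B J := by
      intro h
      obtain ⟨q, hq⟩ := h.lift (ses_cokernel m) i'
      exact indec_no_summand hNI hN q (cokernel.π m ≫ r') (by rw [← Category.assoc, hq, hir']) hBI.1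
        (by omega)
    have zAB : HomZero A B := by
      by_contra h
      exact hAB (ih A B (by omega) hA hB hAI hBI h)
    have zJA : HomZero J A := by
      by_contra h
      exact hJA (ih J A (by omega) hJ hA hJI hAI h)
    have zBJ : HomZero B J := by
      by_contra h
      exact hBJ (ih B J (by omega) hB hJ hBI hJI h)
    have e1 := euler_lt_hdim hA hB hAB
    have e2 := euler_lt_hdim hJ hA hJA
    have e3 := euler_lt_hdim hB hJ hBJ
    rw [hdim_zero zAB] at e1
    rw [hdim_zero zJA] at e2
    rw [hdim_zero zBJ] at e3
    exact hacy _ _ _ (indec_posRoot hft hA hAI) (indec_posRoot hft hB hBI)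
      (indec_posRoot hft hJ hJI) e1 e3 e2

lemma euler_pos_of_hom [IsAlgClosed k] (hft : FiniteType Q) (hacy : Acy Q) (hM : FinDim M)
    (hN : FinDim N) (hMI : Indec M) (hNI : Indec N) (h : ¬ HomZero M N) :
    0 < euler Q (dimVec M) (dimVec N) := by
  rw [← (excl_aux hft hacy _ M N le_rfl hM hN hMI hNI h).hdim hM hN]
  exact hdim_pos hM hN h

lemma euler_nonpos_of_hom (hM : FinDim M) (hN : FinDim N) (h : HomZero M N) :
    euler Q (dimVec M) (dimVec N) ≤ 0 := by
  rw [← hdim_zero h]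
  exact euler_le_hdim hM hN

lemma ne_zero_of_epi {p : M ⟶ N} [Epi p] (h : ¬ IsZero N) : p ≠ 0 := by
  intro e
  apply h
  rw [IsZero.iff_id_eq_zero, ← cancel_epi p, e]
  simp

lemma star_rep (k : Type) [Field k] [IsAlgClosed k] (hft : FiniteType Q) (hacy : Acy Q)
    (S : Set (Q.V → ℤ)) (g f : Q.V → ℤ)
    (hS : ∀ s ∈ S, IsPosRoot Q s) (hg : IsPosRoot Q g) (hf : IsPosRoot Q f)
    (h1 : ∀ s ∈ S, euler Q s f ≤ 0) (h2 : 0 < euler Q g f) :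
    ∃ f', IsPosRoot Q f' ∧ (∀ v, f' v ≤ g v) ∧ (∀ s ∈ S, euler Q s f' ≤ 0) ∧ 0 < euler Q g f' := by
  obtain ⟨G, hG, hGI, rfl⟩ := exists_indec_posRoot (k := k) hft g hg
  obtain ⟨F, hF, hFI, rfl⟩ := exists_indec_posRoot (k := k) hft f hf
  have hGF : ¬ HomZero G F := fun h => by
    have := euler_nonpos_of_hom hG hF h
    omega
  have hGF' := hGF
  unfold HomZero at hGF'
  push Not at hGF'
  obtain ⟨φ, hφ⟩ := hGF'
  obtain ⟨J, e, m, he, hm, hJI, hJ⟩ := exists_mid hG φ hφ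
  refine ⟨dimVec J, indec_posRoot hft hJ hJI, fun v => dimVec_le_of_epi hG e v, ?_, ?_⟩
  · intro s hs
    obtain ⟨A, hA, hAI, rfl⟩ := exists_indec_posRoot (k := k) hft s (hS s hs)
    apply euler_nonpos_of_hom hA hJ
    intro u
    have hz : HomZero A F := by
      by_contra h
      have := euler_pos_of_hom hft hacy hA hF hAI hFI h
      have := h1 _ hs
      omega
    rw [← cancel_mono m, hz (u ≫ m), zero_comp]
  · exact euler_pos_of_hom hft hacy hG hJ hGI hJI fun h => ne_zero_of_epi hJI.1 (h e)

lemma SES.shortExact {i : X ⟶ M} {p : M ⟶ Y} (hs : SES i p) :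
    (ShortComplex.mk i p hs.w).ShortExact := by
  have hi : Mono i := (mono_iff i).mpr hs.inj
  have hp : Epi p := (epi_iff p).mpr hs.surj
  refine { exact := ?_, mono_f := hi, epi_g := hp }
  apply ShortComplex.exact_of_f_is_kernel
  exact KernelFork.IsLimit.ofι' i hs.w (fun {A} q hq =>
    ⟨(hs.liftz q hq).choose, (hs.liftz q hq).choose_spec⟩)

/-- enlarging a subobject -/
lemma exists_pullback {i : X ⟶ M} {p : M ⟶ Y} (hs : SES i p) {I : RepC k Q} (ι : I ⟶ Y) [Mono ι] :
    ∃ (A : RepC k Q) (a : A ⟶ M) (j : X ⟶ A) (q : A ⟶ I), Mono a ∧ SES j q := by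
  have hp : Epi p := (epi_iff p).mpr hs.surj
  have hc := ses_cokernel ι
  let c := p ≫ cokernel.π ι
  have hce : Epi c := epi_comp _ _
  have hk := ses_kernel c
  obtain ⟨q, hq⟩ := hc.liftz (kernel.ι c ≫ p) (by rw [Category.assoc]; exact kernel.condition c)
  obtain ⟨j, hj⟩ := hk.liftz i (by
    change i ≫ p ≫ cokernel.π ι = 0
    rw [← Category.assoc, hs.w, zero_comp])
  have hq' : ∀ v y, co ι v (co q v y) = co p v (co (kernel.ι c) v y) := by
    intro v y
    rw [← co_comp_apply, hq, co_comp_apply]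
  have hj' : ∀ v y, co (kernel.ι c) v (co j v y) = co i v y := by
    intro v y
    rw [← co_comp_apply, hj]
  refine ⟨kernel c, kernel.ι c, j, q, inferInstance, ⟨?_, ?_, ?_, ?_⟩⟩
  · intro v x y hxy
    apply hs.inj v
    rw [← hj', ← hj', hxy]
  · intro v y
    obtain ⟨m, hm⟩ := hs.surj v (co ι v y)
    obtain ⟨b, hb⟩ := hk.ex v m (by
      change co (cokernel.π ι) v (co p v m) = 0
      rw [hm, hc.zero])
    refine ⟨b, hc.inj v ?_⟩
    rw [hq', hb, hm]
  · intro v x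
    apply hc.inj v
    rw [hq', hj', hs.zero, map_zero]
  · intro v y hy
    obtain ⟨x, hx⟩ := hs.ex v (co (kernel.ι c) v y) (by rw [← hq', hy, map_zero])
    refine ⟨x, hk.inj v ?_⟩
    rw [hj', hx]

lemma torsion_closed [IsAlgClosed k] (hft : FiniteType Q) (hacy : Acy Q) (T : Set (RepC k Q))
    (hT : IsTorsionClass T) (hTf : ∀ X ∈ T, FinDim X) (g : Q.V → ℤ) (hg : IsPosRoot Q g)
    (hgS : g ∉ {d | ∃ M ∈ T, Indec M ∧ dimVec M = d}) :
    ∃ f, IsPosRoot Q f ∧ (∀ s ∈ {d | ∃ M ∈ T, Indec M ∧ dimVec M = d}, euler Q s f ≤ 0) ∧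
      0 < euler Q g f := by
  classical
  obtain ⟨G, hG, hGI, rfl⟩ := exists_indec_posRoot (k := k) hft g hg
  have hGT : G ∉ T := fun h => hgS ⟨G, h, hGI, rfl⟩
  have hex : ∃ n : ℕ, ∃ (A : RepC k Q) (i : A ⟶ G), A ∈ T ∧ Mono i ∧ tdim G - tdim A = n :=
    ⟨_, (0 : RepC k Q), 0, hT.zero_mem, ⟨fun a b _ => (isZero_zero _).eq_of_tgt a b⟩, rfl⟩
  obtain ⟨A, i, hAT, hi, hAn⟩ := Nat.find_spec hex
  have hmin : ∀ (B : RepC k Q) (i' : B ⟶ G), B ∈ T → Mono i' → tdim B ≤ tdim A := by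
    intro B i' h1 h2
    have h3 := Nat.find_min' hex ⟨B, i', h1, h2, rfl⟩
    have h4 := tdim_le_of_mono hG i
    have h5 := tdim_le_of_mono hG i'
    omega
  have hs := ses_cokernel i
  have hC : FinDim (cokernel i) := hG.of_epi (cokernel.π i)
  have hz : ∀ X ∈ T, HomZero X (cokernel i) := by
    intro X hX f
    by_contra hf
    obtain ⟨I, e, m, he, hm, hI0, hI, hfac⟩ := exists_factor (hTf X hX) f hf
    obtain ⟨B, b, j, q, hb, hs'⟩ := exists_pullback hs m
    have hIT : I ∈ T := hT.quot_mem X hX I e he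
    have hBT : B ∈ T := hT.ext_mem _ hs'.shortExact hAT hIT
    have h1 := hmin B b hBT hb
    have h2 := hs'.tdim (hTf B hBT)
    have h3 := tdim_pos hI hI0
    omega
  have hne : ¬ IsZero (cokernel i) := by
    intro h
    have : Epi i := Preadditive.epi_of_isZero_cokernel i h
    exact hGT (hT.quot_mem A hAT G i this)
  obtain ⟨N, i', r, hN, hir, hNI⟩ := exists_indec_of_ne hC hne
  have hi' := mono_of_sect hir
  have hr := epi_of_sect hir
  refine ⟨dimVec N, indec_posRoot hft hN hNI, ?_, ?_⟩
  · rintro s ⟨B, hB, hBI, rfl⟩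
    apply euler_nonpos_of_hom (hTf B hB) hN
    intro u
    rw [← cancel_mono i', hz B hB (u ≫ i'), zero_comp]
  · have : Epi (cokernel.π i ≫ r) := epi_comp _ _
    exact euler_pos_of_hom hft hacy hG hN hGI hNI fun h => ne_zero_of_epi hNI.1 (h (cokernel.π i ≫ r))

def torOf (k : Type) [Field k] (S : Set (Q.V → ℤ)) : Set (RepC k Q) :=
  {M | FinDim M ∧ ∀ N : RepC k Q, FinDim N → Indec N → (∀ s ∈ S, euler Q s (dimVec N) ≤ 0) →
    HomZero M N}

lemma torOf_torsion (S : Set (Q.V → ℤ)) : IsTorsionClass (torOf k S) := by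
  have hq : ∀ X ∈ torOf k S, ∀ (Y : RepC k Q) (p : X ⟶ Y), Epi p → Y ∈ torOf k S := by
    rintro X ⟨h1, h2⟩ Y p hp
    refine ⟨h1.of_epi p, fun N hN hNI hNS f => ?_⟩
    rw [← cancel_epi p, h2 N hN hNI hNS (p ≫ f), comp_zero]
  have he : ∀ Sc : ShortComplex (RepC k Q), Sc.ShortExact → Sc.X₁ ∈ torOf k S → Sc.X₃ ∈ torOf k S →
      Sc.X₂ ∈ torOf k S := by
    rintro Sc hSc ⟨h1, h2⟩ ⟨h3, h4⟩
    have hs := ses_of_shortExact Sc hSc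
    refine ⟨hs.finDim h1 h3, fun N hN hNI hNS f => ?_⟩
    obtain ⟨f', hf'⟩ := hs.desc f (h2 N hN hNI hNS _)
    rw [← hf', h4 N hN hNI hNS f', comp_zero]
  refine ⟨?_, ?_, ?_, hq, he⟩
  · refine ⟨fun v => ?_, fun N hN hNI hNS f => (isZero_zero _).eq_zero_of_src f⟩
    have h := isZero_iff.mp (isZero_zero (RepC k Q)) v
    have : Subsingleton (ob (0 : RepC k Q) v) := ⟨fun a b => by rw [h a, h b]⟩
    exact (inferInstance : Module.Finite k (ob (0 : RepC k Q) v))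
  · intro X hX Y hY
    exact he _ (ShortComplex.Splitting.ofHasBinaryBiproduct X Y).shortExact hX hY
  · rintro X hX Y ⟨i, r, e⟩
    exact hq X hX Y r (epi_of_sect e)

lemma torOf_ind [IsAlgClosed k] (hft : FiniteType Q) (hacy : Acy Q) (S : Set (Q.V → ℤ))
    (hS : ∀ s ∈ S, IsPosRoot Q s)
    (hcl : ∀ g, IsPosRoot Q g → g ∉ S → ∃ f, IsPosRoot Q f ∧ (∀ s ∈ S, euler Q s f ≤ 0) ∧
      0 < euler Q g f) : S = {d | ∃ M ∈ torOf k S, Indec M ∧ dimVec M = d} := by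
  ext d
  constructor
  · intro hd
    obtain ⟨M, hM, hMI, rfl⟩ := exists_indec_posRoot (k := k) hft d (hS d hd)
    refine ⟨M, ⟨hM, fun N hN hNI hNS => ?_⟩, hMI, rfl⟩
    by_contra h
    have := euler_pos_of_hom hft hacy hM hN hMI hNI h
    have := hNS _ hd
    omega
  · rintro ⟨M, ⟨hM, h2⟩, hMI, rfl⟩
    by_contra hd
    obtain ⟨f, hf, hf1, hf2⟩ := hcl _ (indec_posRoot hft hM hMI) hd
    obtain ⟨N, hN, hNI, rfl⟩ := exists_indec_posRoot (k := k) hft f hf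
    have := euler_nonpos_of_hom hM hN (h2 N hN hNI hf1)
    omega

end Excl

/-! ### Assembly -/

section Assembly

open scoped Classical

/-- the orientation of the underlying graph of `Q` determined by `pos` -/
def Qp (Q : FinQuiver) (pos : Q.V → ℕ) : FinQuiver where
  V := Q.V
  quiver := ⟨fun x y => {_a : (x ⟶ y) ⊕ (y ⟶ x) // pos x < pos y}⟩
  fintypeV := Q.fintypeV
  fintypeArr := fun x y => (inferInstance : Fintype {_a : (x ⟶ y) ⊕ (y ⟶ x) // pos x < pos y})
  acyclic := by
    let q : Quiver.{0} Q.V := ⟨fun x y => {_a : (x ⟶ y) ⊕ (y ⟶ x) // pos x < pos y}⟩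
    have key : ∀ (v w : Q.V) (p : @Quiver.Path Q.V q v w),
        pos v + @Quiver.Path.length Q.V q v w p ≤ pos w := by
      intro v w p
      induction p with
      | nil => exact le_rfl
      | cons p a ih =>
        have := a.2
        rw [@Quiver.Path.length_cons Q.V q]
        omega
    intro v p
    have h := key v v p
    exact @Quiver.Path.eq_nil_of_length_zero Q.V q v p (by omega)

lemma card_Qp (pos : Q.V → ℕ) (x y : (Qp Q pos).V) :
    (Fintype.card (x ⟶ y) : ℤ)
      = if pos x < pos y then adj Q x y else 0 := by
  let x' : Q.V := x
  let y' : Q.V := y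
  have e : Fintype.card (x ⟶ y) = Fintype.card {_a : (x' ⟶ y') ⊕ (y' ⟶ x') // pos x' < pos y'} := rfl
  rw [e]
  by_cases h : pos x' < pos y'
  · rw [if_pos h, Fintype.card_congr (Equiv.subtypeUnivEquiv fun _ => h), Fintype.card_sum]
    unfold adj
    push_cast
    rfl
  · rw [if_neg h]
    have : IsEmpty {_a : (x' ⟶ y') ⊕ (y' ⟶ x') // pos x' < pos y'} := ⟨fun a => h a.2⟩
    rw [Fintype.card_of_isEmpty]; rfl

lemma adj_Qp (pos : Q.V → ℕ) (hpos : Function.Injective pos) (x y : (Qp Q pos).V) :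
    adj (Qp Q pos) x y = adj Q x y := by
  by_cases hxy : x = y
  · subst hxy
    exact (adj_self _).trans (adj_self (Q := Q) _).symm
  · have h1 : adj (Qp Q pos) x y = (Fintype.card (x ⟶ y) : ℤ) + Fintype.card (y ⟶ x) := rfl
    rw [h1, card_Qp, card_Qp]
    rcases lt_trichotomy (pos x) (pos y) with h | h | h
    · rw [if_pos h, if_neg (by omega), add_zero]
    · exact absurd (hpos h) hxy
    · rw [if_pos h, if_neg (by omega), zero_add]; exact adj_comm _ _

lemma euler_Qp (pos : Q.V → ℕ) (a b : Q.V → ℤ) : euler (Qp Q pos) (R := ℤ) a b = eu pos a b := by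
  refine (euler_eq (Q := Qp Q pos) a b).trans ?_
  have h : ∀ i j : (Qp Q pos).V, ((Fintype.card (i ⟶ j) : ℕ) : ℤ) * (a i * b j)
      = if pos i < pos j then adj Q i j * (a i * b j) else 0 := by
    intro i j
    rw [card_Qp]
    split <;> simp
  unfold eu
  congr 1
  exact Finset.sum_congr rfl fun i _ => Finset.sum_congr rfl fun j _ => h i j

lemma symEuler_Qp (pos : Q.V → ℕ) (hpos : Function.Injective pos) {R : Type} [CommRing R]
    (a b : Q.V → R) : symEuler (Qp Q pos) (R := R) a b = symEuler Q a b := by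
  refine (symEuler_eq (Q := Qp Q pos) a b).trans (Eq.trans ?_ (symEuler_eq a b).symm)
  congr 1
  refine Finset.sum_congr rfl fun i _ => Finset.sum_congr rfl fun j _ => ?_
  rw [adj_Qp pos hpos]

lemma posRoot_Qp (pos : Q.V → ℕ) (hpos : Function.Injective pos) (a : Q.V → ℤ) :
    IsPosRoot (Qp Q pos) a ↔ IsPosRoot Q a := by
  have h := symEuler_Qp pos hpos a a
  constructor
  · rintro ⟨h1, h2, h3⟩; exact ⟨h1, h2, h.symm.trans h3⟩
  · rintro ⟨h1, h2, h3⟩; exact ⟨h1, h2, h.trans h3⟩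

lemma finiteType_Qp (hft : FiniteType Q) (pos : Q.V → ℕ) (hpos : Function.Injective pos) :
    FiniteType (Qp Q pos) := by
  intro a ha
  have h := hft a ha
  exact h.trans_eq (symEuler_Qp pos hpos a a).symm

lemma acy_Qp (hft : FiniteType Q) (pos : Q.V → ℕ) (hpos : Function.Injective pos) :
    Acy (Qp Q pos) := by
  intro a b c ha hb hc h1 h2 h3
  exact eu_acyclic hft pos hpos ((posRoot_Qp pos hpos a).mp ha) ((posRoot_Qp pos hpos b).mp hb)
    ((posRoot_Qp pos hpos c).mp hc) ((euler_Qp pos a b).symm.trans_lt h1)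
    ((euler_Qp pos b c).symm.trans_lt h2) ((euler_Qp pos c a).symm.trans_lt h3)

lemma starP (k : Type) [Field k] [IsAlgClosed k] (hft : FiniteType Q) (pos : Q.V → ℕ)
    (hpos : Function.Injective pos) : StarP pos := by
  intro S g f hS hg hf h1 h2
  obtain ⟨f', e1, e2, e3, e4⟩ := star_rep k (finiteType_Qp hft pos hpos) (acy_Qp hft pos hpos) S g f
    (fun s hs => (posRoot_Qp pos hpos s).mpr (hS s hs)) ((posRoot_Qp pos hpos g).mpr hg)
    ((posRoot_Qp pos hpos f).mpr hf) (fun s hs => (euler_Qp pos s f).trans_le (h1 s hs))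
    (h2.trans_eq (euler_Qp pos g f).symm)
  exact ⟨f', (posRoot_Qp pos hpos f').mp e1, e2, fun s hs => (euler_Qp pos s f').symm.trans_le (e3 s hs),
    e4.trans_eq (euler_Qp pos g f')⟩

variable (ord : Fin (Fintype.card Q.V) ≃ Q.V)

def pos0 (v : Q.V) : ℕ := (ord.symm v : ℕ)

lemma pos0_inj : Function.Injective (pos0 ord) := fun _ _ h =>
  ord.symm.injective (Fin.ext h)

lemma sorted_pos0 : Sorted (pos0 ord) (List.ofFn fun i => ord i) := by
  unfold Sorted
  rw [List.pairwise_ofFn]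
  intro i j hij
  unfold pos0
  simpa using hij

lemma supp_pos0 (a : Q.V → ℤ) : Supp (List.ofFn fun i => ord i) a := fun v hv =>
  absurd (List.mem_ofFn.mpr (ord.surjective v)) hv

lemma eu_pos0 (hord : OrdCompatible Q ord) (a b : Q.V → ℤ) : eu (pos0 ord) a b = euler Q a b := by
  rw [euler_eq]
  unfold eu
  congr 1
  refine Finset.sum_congr rfl fun i _ => Finset.sum_congr rfl fun j _ => ?_
  have hc : ∀ i j : Q.V, ¬ pos0 ord i < pos0 ord j → Fintype.card (i ⟶ j) = 0 := by
    intro i j h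
    rw [Fintype.card_eq_zero_iff]
    exact ⟨fun a => h (hord i j a)⟩
  split_ifs with h
  · unfold adj
    rw [hc j i (by omega)]
    simp
  · rw [hc i j h]
    simp

end Assembly

end Helpers18

/-- For `Q` of finite (Dynkin) type there is a bijection between
torsion classes in `rep Q` and `cox(Q)`-sortable elements of `W`, given by
`T ↦ w_T`, where `w_T` is the unique element whose inversion set `I(w_T)` equals
`Ind(T)`, the set of positive roots that are dimension vectors of indecomposable
objects of `T`. -/
theorem statement18 (k : Type) [Field k] [IsAlgClosed k] (Q : FinQuiver)
    (hft : FiniteType Q)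
    (ord : Fin (Fintype.card Q.V) ≃ Q.V) (hord : OrdCompatible Q ord) :
    (∀ T : Set (RepC k Q), IsTorsionClass T → (∀ X ∈ T, FinDim X) →
      ∃! w : (Q.V → ℤ) → (Q.V → ℤ), InW Q w ∧ CSortable Q ord w ∧
        InvSet Q w = { d | ∃ M ∈ T, Indec M ∧ dimVec M = d }) ∧
    (∀ w : (Q.V → ℤ) → (Q.V → ℤ), InW Q w → CSortable Q ord w →
      ∃ T : Set (RepC k Q), IsTorsionClass T ∧ (∀ X ∈ T, FinDim X) ∧
        InvSet Q w = { d | ∃ M ∈ T, Indec M ∧ dimVec M = d }) := by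
  have hacy : Acy Q := by
    intro a b c ha hb hc h1 h2 h3
    rw [← eu_pos0 ord hord] at h1 h2 h3
    exact eu_acyclic hft (pos0 ord) (pos0_inj ord) ha hb hc h1 h2 h3
  constructor
  · intro T hT hTf
    set S : Set (Q.V → ℤ) := { d | ∃ M ∈ T, Indec M ∧ dimVec M = d } with hS
    have hSr : ∀ s ∈ S, IsPosRoot Q s := by
      rintro s ⟨M, hM, hMI, rfl⟩
      exact indec_posRoot hft (hTf M hM) hMI
    have hCl : Cl (pos0 ord) (List.ofFn fun i => ord i) S := by
      refine ⟨fun s hs => ⟨hSr s hs, supp_pos0 ord s⟩, fun g hg hgS => ?_⟩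
      obtain ⟨f, h1, h2, h3⟩ := torsion_closed hft hacy T hT hTf g hg.1 hgS
      refine ⟨f, ⟨h1, supp_pos0 ord f⟩, fun s hs => ?_, ?_⟩
      · rw [eu_pos0 ord hord]; exact h2 s hs
      · rw [eu_pos0 ord hord]; exact h3
    obtain ⟨u, h1, h2, h3⟩ := cl_word hft (fun pos hpos => starP k hft pos hpos) _ (pos0 ord) _ S
      (pos0_inj ord) (sorted_pos0 ord) hCl le_rfl
    refine ⟨wordProd Q u, ⟨⟨u, rfl⟩, ?_, ?_⟩, ?_⟩
    · exact (csort_iff ord _).mpr ⟨u, h1, red_of_ncard hft (by rw [h2, h3]), rfl⟩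
    · rw [InvSet_eq, h2]
    · rintro w ⟨⟨l, rfl⟩, _, hw⟩
      rw [InvSet_eq] at hw
      exact inv_inj hft l u (by rw [hw, h2])
  · intro w _ hw
    obtain ⟨u, h1, h2, rfl⟩ := (csort_iff ord w).mp hw
    have hCl := word_cl hft h1 h2 (pos0 ord) (pos0_inj ord) (sorted_pos0 ord)
    refine ⟨torOf k (inv u), torOf_torsion (inv u), fun X hX => hX.1, ?_⟩
    rw [InvSet_eq]
    refine torOf_ind hft hacy (inv u) (fun s hs => (hCl.1 s hs).1) fun g hg hgS => ?_
    obtain ⟨f, e1, e2, e3⟩ := hCl.2 g ⟨hg, supp_pos0 ord g⟩ hgS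
    refine ⟨f, e1.1, fun s hs => ?_, ?_⟩
    · rw [← eu_pos0 ord hord]; exact e2 s hs
    · rw [← eu_pos0 ord hord]; exact e3

end Statement18
end NCPaper
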